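/- Let T : ℝ^d × 𝒳 → 𝒳 be a continuous action of ℝ^d on a compact metric space (𝒳, 𝐝). Let λ be a Borel probability measure on M^T(𝒳) and let μ = ∫_{M^T(𝒳)} ν dλ(ν) be its barycenter. Let ε > 0 and let M^T(𝒳) ∋ ν ↦ ε_ν ∈ (0,∞) be any measurable function with ∫_{M^T(𝒳)} ε_ν dλ(ν) ≤ ε. Then R(𝐝, μ, ε) ≤ ∫_{M^T(𝒳)} R(𝐝, ν, ε_ν) dλ(ν). -/

import Mathlib

open MeasureTheory Filter Set
open scoped ENNReal Topology NNReal

noncomputable section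

/-- Shannon entropy (base 2) of a finitely-valued random variable. -/
def shannonEntropy {Ω S : Type*} [MeasurableSpace Ω] [Fintype S]
    (P : Measure Ω) (f : Ω → S) : ℝ :=
  -∑ i : S, ((P (f ⁻¹' {i})).toReal * Real.logb 2 ((P (f ⁻¹' {i})).toReal))

/-- Mutual information (base 2) of two random variables, defined as the supremum over all
finite measurable partitions (encoded as measurable maps into `Fin n`) of
`H(α∘X) + H(β∘Y) - H(α∘X, β∘Y)`. -/
def mutualInfo {Ω A B : Type*} [MeasurableSpace Ω] [MeasurableSpace A] [MeasurableSpace B]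
    (P : Measure Ω) (X : Ω → A) (Y : Ω → B) : ℝ≥0∞ :=
  ⨆ (n : ℕ) (m : ℕ) (α : A → Fin n) (_ : Measurable α) (β : B → Fin m) (_ : Measurable β),
    ENNReal.ofReal (shannonEntropy P (fun ω => α (X ω)) + shannonEntropy P (fun ω => β (Y ω))
      - shannonEntropy P (fun ω => (α (X ω), β (Y ω))))

/-- The box `[0,L)^d ⊆ ℝ^d`. -/
def unitBox (d : ℕ) (L : ℝ) : Set (Fin d → ℝ) := Set.univ.pi fun _ => Set.Ico (0 : ℝ) L

/-- Lebesgue measure on `ℝ^d` restricted to the box `[0,L)^d`. -/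
def boxMeasure (d : ℕ) (L : ℝ) : Measure (Fin d → ℝ) := volume.restrict (unitBox d L)

/-- The space `L¹([0,L)^d, X)` of measurable maps modulo a.e. equality. -/
abbrev L1Maps (d : ℕ) (L : ℝ) (X : Type*) [TopologicalSpace X] :=
  (Fin d → ℝ) →ₘ[boxMeasure d L] X

/-- The `L¹` distance `D(f,g) = ∫_{[0,L)^d} 𝐝(f(u), g(u)) dm(u)`. -/
def L1dist {d : ℕ} {L : ℝ} {X : Type*} [MetricSpace X] (f g : L1Maps d L X) : ℝ :=
  ∫ u, dist (f u) (g u) ∂(boxMeasure d L)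

/-- The Borel σ-algebra of the metric `L1dist` on `L¹([0,L)^d, X)`,
generated by the open balls of the metric. -/
instance L1Maps.measurableSpace {d : ℕ} {L : ℝ} {X : Type*} [MetricSpace X] :
    MeasurableSpace (L1Maps d L X) :=
  MeasurableSpace.generateFrom {s | ∃ (f : L1Maps d L X) (r : ℝ), s = {g | L1dist f g < r}}

/-- The expected mean distortion `E[(1/L^d) ∫_{[0,L)^d} 𝐝(T^u X, Y_u) dm(u)]`. -/
def distortion {X : Type*} [MetricSpace X] (d : ℕ) (T : (Fin d → ℝ) → X → X) (L : ℝ)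
    {Ω : Type*} [MeasurableSpace Ω] (P : Measure Ω) (Xv : Ω → X) (Yv : Ω → L1Maps d L X) : ℝ :=
  ∫ ω, (L ^ d)⁻¹ * ∫ u, dist (T u (Xv ω)) (Yv ω u) ∂(boxMeasure d L) ∂P

/-- `R_L(𝐝, μ, ε)`: the infimum of `I(X;Y)` over all pairs of random variables on a common
probability space with `Law X = μ`, `Y` taking values in `L¹([0,L)^d, X)` and expected mean
distortion `< ε`. -/
def RL {X : Type*} [MetricSpace X] [MeasurableSpace X] (d : ℕ)
    (T : (Fin d → ℝ) → X → X) (μ : Measure X) (L ε : ℝ) : ℝ≥0∞ :=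
  ⨅ (Ω : Type) (_ : MeasurableSpace Ω) (P : Measure Ω) (_ : IsProbabilityMeasure P)
    (Xv : Ω → X) (Yv : Ω → L1Maps d L X) (_ : Measurable Xv) (_ : Measurable Yv)
    (_ : Measure.map Xv P = μ) (_ : distortion d T L P Xv Yv < ε),
    mutualInfo P Xv Yv

/-- The rate distortion function `R(𝐝, μ, ε) = lim_{L→∞} R_L(𝐝, μ, ε)/L^d`, which exists and
equals `inf_{L>0} R_L(𝐝, μ, ε)/L^d`. -/
def RD {X : Type*} [MetricSpace X] [MeasurableSpace X] (d : ℕ)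
    (T : (Fin d → ℝ) → X → X) (μ : Measure X) (ε : ℝ) : ℝ≥0∞ :=
  ⨅ (L : ℝ) (_ : 0 < L), RL d T μ L ε / ENNReal.ofReal (L ^ d)

/-- Upper rate distortion dimension. -/
def urdim {X : Type*} [MetricSpace X] [MeasurableSpace X] (d : ℕ)
    (T : (Fin d → ℝ) → X → X) (μ : Measure X) : ℝ≥0∞ :=
  Filter.limsup (fun ε : ℝ => RD d T μ ε / ENNReal.ofReal (Real.logb 2 (1 / ε))) (𝓝[>] (0 : ℝ))

/-- Lower rate distortion dimension. -/
def lrdim {X : Type*} [MetricSpace X] [MeasurableSpace X] (d : ℕ)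
    (T : (Fin d → ℝ) → X → X) (μ : Measure X) : ℝ≥0∞ :=
  Filter.liminf (fun ε : ℝ => RD d T μ ε / ENNReal.ofReal (Real.logb 2 (1 / ε))) (𝓝[>] (0 : ℝ))

/-- `μ` is invariant under the `ℝ^d`-action `T`. -/
def MeasInvariant {X : Type*} [MeasurableSpace X] (d : ℕ)
    (T : (Fin d → ℝ) → X → X) (μ : Measure X) : Prop :=
  ∀ u : Fin d → ℝ, Measure.map (T u) μ = μ

/-- `T` is a continuous action of the additive group `ℝ^d`. -/
def IsContAction {X : Type*} [TopologicalSpace X] (d : ℕ) (T : (Fin d → ℝ) → X → X) : Prop :=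
  Continuous (fun p : (Fin d → ℝ) × X => T p.1 p.2) ∧ (∀ x, T 0 x = x) ∧
    ∀ u v x, T (u + v) x = T u (T v x)

/-- The metric `𝐝_L(x,y) = sup_{u ∈ [0,L)^d} 𝐝(T^u x, T^u y)`. -/
def dSup {X : Type*} [MetricSpace X] (d : ℕ) (T : (Fin d → ℝ) → X → X) (L : ℝ) (x y : X) : ℝ :=
  ⨆ u : unitBox d L, dist (T u.1 x) (T u.1 y)

/-- The `ε`-covering number of `X` for the (pre)metric `ρ`: the minimal number of open sets
of `ρ`-diameter `< ε` covering `X`. -/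
def covNum (X : Type*) [TopologicalSpace X] (ρ : X → X → ℝ) (ε : ℝ) : ℕ :=
  sInf {n : ℕ | ∃ F : Finset (Set X), F.card = n ∧
    (∀ U ∈ F, IsOpen U ∧ (⨆ x ∈ U, ⨆ y ∈ U, ENNReal.ofReal (ρ x y)) < ENNReal.ofReal ε) ∧
    ⋃₀ (F : Set (Set X)) = Set.univ}

/-- The entropy at scale `ε`: `S(X,T,𝐝,ε) = lim_{L→∞} log₂ #(X, 𝐝_L, ε) / L^d`
(the limit exists, hence equals the limsup used here). -/
def entScale {X : Type*} [MetricSpace X] (d : ℕ) (T : (Fin d → ℝ) → X → X) (ε : ℝ) : ℝ≥0∞ :=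
  Filter.limsup
    (fun L : ℝ => ENNReal.ofReal (Real.logb 2 (covNum X (dSup d T L) ε) / L ^ d)) Filter.atTop

/-- The upper metric mean dimension. -/
def umdim {X : Type*} [MetricSpace X] (d : ℕ) (T : (Fin d → ℝ) → X → X) : ℝ≥0∞ :=
  Filter.limsup (fun ε : ℝ => entScale d T ε / ENNReal.ofReal (Real.logb 2 (1 / ε))) (𝓝[>] (0 : ℝ))

/-- The σ-algebra on the space of Borel probability measures on `X` (for a compact metric `X`
this is the Borel σ-algebra of the weak* topology). -/
instance ProbabilityMeasure.measurableSpace' {α : Type*} [MeasurableSpace α] :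
    MeasurableSpace (ProbabilityMeasure α) :=
  inferInstanceAs (MeasurableSpace {μ : Measure α // IsProbabilityMeasure μ})

/-- The space `M^T(X)` of `T`-invariant Borel probability measures on `X`. -/
abbrev InvM (X : Type*) [MeasurableSpace X] [MetricSpace X] (d : ℕ)
    (T : (Fin d → ℝ) → X → X) :=
  {ν : ProbabilityMeasure X // MeasInvariant d T (ν : Measure X)}

end

set_option linter.unusedSectionVars false

section basics

variable {X : Type*} [MetricSpace X] [CompactSpace X] [MeasurableSpace X] [BorelSpace X]

/-- Unnormalised distortion between the orbit of a point and a map. -/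
noncomputable def Dd (d : ℕ) (T : (Fin d → ℝ) → X → X) (L : ℝ) (x : X) (y : L1Maps d L X) : ℝ :=
  ∫ u, dist (T u x) (y u) ∂(boxMeasure d L)

lemma measurableSet_unitBox (d : ℕ) (L : ℝ) : MeasurableSet (unitBox d L) :=
  MeasurableSet.univ_pi fun _ => measurableSet_Ico

lemma volume_unitBox (d : ℕ) (L : ℝ) : volume (unitBox d L) = ENNReal.ofReal L ^ d := by
  have h := Real.volume_pi_Ico (a := fun _ : Fin d => (0 : ℝ)) (b := fun _ => L)
  simpa [unitBox] using h

instance boxMeasure_finite (d : ℕ) (L : ℝ) : IsFiniteMeasure (boxMeasure d L) := by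
  constructor
  rw [boxMeasure, Measure.restrict_apply_univ, volume_unitBox]
  exact ENNReal.pow_lt_top ENNReal.ofReal_lt_top

lemma boxMeasure_real_univ (d : ℕ) {L : ℝ} (hL : 0 ≤ L) : (boxMeasure d L).real univ = L ^ d := by
  rw [Measure.real, boxMeasure, Measure.restrict_apply_univ, volume_unitBox, ENNReal.toReal_pow,
    ENNReal.toReal_ofReal hL]

/-- The diameter of the space. -/
noncomputable def dia (X : Type*) [MetricSpace X] : ℝ := Metric.diam (univ : Set X)

lemma dist_le_dia (x y : X) : dist x y ≤ dia X :=
  Metric.dist_le_diam_of_mem isCompact_univ.isBounded (mem_univ _) (mem_univ _)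

lemma dia_nonneg : 0 ≤ dia X := Metric.diam_nonneg

variable {d : ℕ} {T : (Fin d → ℝ) → X → X} {L : ℝ}

lemma IsContAction.cont_left (hT : IsContAction d T) (x : X) : Continuous fun u => T u x :=
  hT.1.comp (by fun_prop : Continuous fun u : Fin d → ℝ => (u, x))

lemma IsContAction.cont_right (hT : IsContAction d T) (u : Fin d → ℝ) : Continuous (T u) :=
  hT.1.comp (by fun_prop : Continuous fun x : X => (u, x))

lemma Dd_integrable_of (hT : IsContAction d T) (x : X) {g : (Fin d → ℝ) → X} {m : Measure (Fin d → ℝ)}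
    [IsFiniteMeasure m] (hg : AEStronglyMeasurable g m) :
    Integrable (fun u => dist (T u x) (g u)) m := by
  refine Integrable.of_bound (C := dia X) ?_ (ae_of_all _ fun u => ?_)
  · exact ((hT.cont_left x).aestronglyMeasurable).dist hg
  · rw [Real.norm_of_nonneg dist_nonneg]; exact dist_le_dia _ _

lemma Dd_integrable (hT : IsContAction d T) (x : X) (y : L1Maps d L X) :
    Integrable (fun u => dist (T u x) (y u)) (boxMeasure d L) :=
  Dd_integrable_of hT x y.aestronglyMeasurable

lemma Dd_nonneg (x : X) (y : L1Maps d L X) : 0 ≤ Dd d T L x y :=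
  integral_nonneg fun _ => dist_nonneg

lemma Dd_le (hT : IsContAction d T) (hL : 0 ≤ L) (x : X) (y : L1Maps d L X) :
    Dd d T L x y ≤ L ^ d * dia X := by
  have := integral_mono (Dd_integrable hT x y) (integrable_const (dia X))
    (fun u => dist_le_dia _ _)
  simpa [Dd, boxMeasure_real_univ d hL] using this

lemma Dd_close (hT : IsContAction d T) (hL : 0 ≤ L) {x x' : X} {δ : ℝ}
    (h : ∀ u ∈ unitBox d L, dist (T u x) (T u x') ≤ δ) (y : L1Maps d L X) :
    |Dd d T L x y - Dd d T L x' y| ≤ L ^ d * δ := by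
  rw [Dd, Dd, ← integral_sub (Dd_integrable hT x y) (Dd_integrable hT x' y), ← Real.norm_eq_abs]
  have := norm_integral_le_of_norm_le_const (μ := boxMeasure d L) (C := δ)
    (f := fun u => dist (T u x) (y u) - dist (T u x') (y u)) ?_
  · rw [boxMeasure_real_univ d hL] at this
    linarith
  · have hm : ∀ᵐ u ∂(boxMeasure d L), u ∈ unitBox d L :=
      ae_restrict_mem (measurableSet_unitBox d L)
    filter_upwards [hm] with u hu
    rw [Real.norm_eq_abs]
    exact (abs_dist_sub_le _ _ _).trans (h u hu)

lemma Dd_measurable_right (hT : IsContAction d T) (x : X) :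
    Measurable (fun y : L1Maps d L X => Dd d T L x y) := by
  let g : L1Maps d L X := AEEqFun.mk (fun u => T u x) (hT.cont_left x).aestronglyMeasurable
  have : (fun y : L1Maps d L X => Dd d T L x y) = fun y => L1dist g y := by
    funext y
    refine integral_congr_ae ?_
    have := AEEqFun.coeFn_mk (μ := boxMeasure d L) (fun u => T u x)
      (hT.cont_left x).aestronglyMeasurable
    filter_upwards [this] with u hu
    show _ = dist (g u) (y u)
    rw [show g u = T u x from hu]
  rw [this]
  refine measurable_of_Iio fun r => ?_
  exact MeasurableSpace.measurableSet_generateFrom ⟨g, r, rfl⟩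

lemma Dd_measurable_left (hT : IsContAction d T) (y : L1Maps d L X) :
    Measurable (fun x : X => Dd d T L x y) := by
  have h : StronglyMeasurable fun p : X × (Fin d → ℝ) => dist (T p.2 p.1) (y p.2) := by
    apply Measurable.stronglyMeasurable
    apply Measurable.dist
    · exact (hT.1.comp continuous_swap).measurable
    · exact y.stronglyMeasurable.measurable.comp measurable_snd
  exact (h.integral_prod_right (ν := boxMeasure d L)).measurable

lemma exists_unif (hT : IsContAction d T) (L : ℝ) {δ : ℝ} (hδ : 0 < δ) :
    ∃ η > 0, ∀ x x' : X, dist x x' < η → ∀ u ∈ unitBox d L, dist (T u x) (T u x') ≤ δ := by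
  have hK : IsCompact ((Set.univ.pi fun _ : Fin d => Set.Icc (0 : ℝ) L) ×ˢ (univ : Set X)) :=
    (isCompact_univ_pi fun _ => isCompact_Icc).prod isCompact_univ
  have := hK.uniformContinuousOn_of_continuous hT.1.continuousOn
  rw [Metric.uniformContinuousOn_iff] at this
  obtain ⟨η, hη, h⟩ := this δ hδ
  refine ⟨η, hη, fun x x' hx u hu => (h (u, x) ?_ (u, x') ?_ ?_).le⟩
  · exact ⟨fun i hi => Ico_subset_Icc_self (hu i hi), mem_univ _⟩
  · exact ⟨fun i hi => Ico_subset_Icc_self (hu i hi), mem_univ _⟩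
  · simpa [Prod.dist_eq] using hx

/-- Finite measurable partition with representatives, adapted to the box dynamics. -/
lemma exists_partition [Nonempty X] (hT : IsContAction d T) (L : ℝ) {δ : ℝ} (hδ : 0 < δ) :
    ∃ (k : ℕ) (α : X → Fin k) (r : Fin k → X), Measurable α ∧
      ∀ x, ∀ u ∈ unitBox d L, dist (T u x) (T u (r (α x))) ≤ δ := by
  obtain ⟨η, hη, h⟩ := exists_unif hT L hδ
  let e := TopologicalSpace.denseSeq X
  have hcov : (univ : Set X) ⊆ ⋃ n, Metric.ball (e n) η := by
    intro x _
    obtain ⟨n, hn⟩ := (TopologicalSpace.denseRange_denseSeq X).exists_dist_lt x hη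
    exact mem_iUnion.2 ⟨n, by simpa [Metric.mem_ball] using hn⟩
  obtain ⟨t, ht⟩ := isCompact_univ.elim_finite_subcover _ (fun n => Metric.isOpen_ball) hcov
  let N := t.sup id
  let ind := SimpleFunc.nearestPtInd e N
  have hle : ∀ x, ind x < N + 1 := fun x =>
    Nat.lt_succ_of_le (SimpleFunc.nearestPtInd_le e N x)
  refine ⟨N + 1, fun x => ⟨ind x, hle x⟩, fun i => e i, ?_, ?_⟩
  · refine measurable_to_countable' fun i => ?_
    have : (fun x => (⟨ind x, hle x⟩ : Fin (N + 1))) ⁻¹' {i} = ind ⁻¹' {(i : ℕ)} := by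
      ext x; simp [Fin.ext_iff]
    rw [this]
    exact ind.measurableSet_preimage _
  · intro x u hu
    refine h x _ ?_ u hu
    obtain ⟨n, hn⟩ := mem_iUnion.1 (ht (mem_univ x))
    obtain ⟨hnt, hn⟩ := mem_iUnion.1 hn
    have h1 := SimpleFunc.edist_nearestPt_le e x (k := n) (N := N) (Finset.le_sup (f := id) hnt)
    rw [edist_dist, edist_dist] at h1
    have h2 := (ENNReal.ofReal_le_ofReal_iff dist_nonneg).1 h1
    have h3 : SimpleFunc.nearestPt e N x = e (ind x) := rfl
    rw [h3] at h2
    calc dist x (e (ind x)) = dist (e (ind x)) x := dist_comm _ _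
      _ ≤ _ := h2
      _ < η := by rw [dist_comm]; exact hn

lemma Dd_measurable [Nonempty X] (hT : IsContAction d T) (hL : 0 ≤ L) {Ω : Type*} [MeasurableSpace Ω]
    {Xv : Ω → X} {Yv : Ω → L1Maps d L X} (hX : Measurable Xv) (hY : Measurable Yv) :
    Measurable fun ω => Dd d T L (Xv ω) (Yv ω) := by
  have hpos : ∀ n : ℕ, (0 : ℝ) < 1 / ((n : ℝ) + 1) := fun n => by positivity
  choose k α r hα hr using fun n : ℕ => exists_partition hT L (hpos n)
  refine measurable_of_tendsto_metrizable
    (f := fun (n : ℕ) ω => Dd d T L (r n (α n (Xv ω))) (Yv ω)) (fun n => ?_) ?_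
  · have h1 : Measurable fun p : Fin (k n) × Ω => Dd d T L (r n p.1) (Yv p.2) :=
      measurable_from_prod_countable_right fun i => (Dd_measurable_right hT (r n i)).comp hY
    exact h1.comp (((hα n).comp hX).prodMk measurable_id)
  · rw [tendsto_pi_nhds]
    intro ω
    rw [tendsto_iff_dist_tendsto_zero]
    refine squeeze_zero (fun _ => dist_nonneg) (g := fun n : ℕ => L ^ d * (1 / ((n : ℝ) + 1)))
      (fun n => ?_) ?_
    · rw [dist_comm, Real.dist_eq]
      exact Dd_close hT hL (hr n (Xv ω)) (Yv ω)
    · simpa using (tendsto_one_div_add_atTop_nhds_zero_nat (𝕜 := ℝ)).const_mul (L ^ d)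

end basics


section info

lemma tangent_ineq {w q κ : ℝ} (hw : 0 ≤ w) (hq : 0 ≤ q) (hq0 : q = 0 → w = 0) (hκ : 0 < κ) :
    w * Real.logb 2 κ + (w - q * κ) / Real.log 2 ≤ w * Real.logb 2 (w / q) := by
  have hl : 0 < Real.log 2 := Real.log_pos one_lt_two
  rcases hw.eq_or_lt with rfl | hw'
  · have : 0 ≤ q * κ / Real.log 2 := by positivity
    simp only [zero_mul, zero_sub, neg_div, zero_add]
    linarith
  · have hq' : 0 < q := hq.lt_of_ne fun h => hw'.ne' (hq0 h.symm)
    have h1 := Real.one_sub_inv_le_log_of_pos (x := w / q / κ) (by positivity)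
    rw [Real.log_div (by positivity) hκ.ne'] at h1
    have h2 := mul_le_mul_of_nonneg_left h1 hw
    have h3 : w * (1 - (w / q / κ)⁻¹) = w - q * κ := by field_simp
    rw [h3] at h2
    simp only [Real.logb]
    rw [mul_div_assoc', mul_div_assoc', ← add_div]
    gcongr
    linarith

lemma abs_cost_le {w q : ℝ} (hw : 0 ≤ w) (hw1 : w ≤ 1) :
    |w * Real.logb 2 (w / q)| ≤ (1 + |Real.log q|) / Real.log 2 := by
  have hl : 0 < Real.log 2 := Real.log_pos one_lt_two
  rw [Real.logb, mul_div_assoc', abs_div, abs_of_pos hl]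
  gcongr
  by_cases h0 : w = 0
  · subst h0; simp; positivity
  by_cases hq : q = 0
  · subst hq; simp
  rw [Real.log_div h0 hq, mul_sub]
  have h1 : |w * Real.log w| ≤ 1 := by
    have := (Real.abs_log_mul_self_lt w (hw.lt_of_ne (Ne.symm h0)) hw1).le
    rwa [mul_comm] at this
  have h2 : |w * Real.log q| ≤ |Real.log q| := by
    rw [abs_mul, abs_of_nonneg hw]
    exact mul_le_of_le_one_left (abs_nonneg _) hw1
  exact (abs_sub _ _).trans (add_le_add h1 h2)

lemma entropy_eq {Ω : Type*} [MeasurableSpace Ω] (P : Measure Ω) [IsFiniteMeasure P] {n m : ℕ}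
    {A : Ω → Fin n} {B : Ω → Fin m} (hA : Measurable A) (hB : Measurable B) :
    shannonEntropy P A + shannonEntropy P B - shannonEntropy P (fun ω => (A ω, B ω)) =
      ∑ i, ∑ j, P.real (A ⁻¹' {i} ∩ B ⁻¹' {j}) *
        Real.logb 2 (P.real (A ⁻¹' {i} ∩ B ⁻¹' {j}) /
          (P.real (A ⁻¹' {i}) * P.real (B ⁻¹' {j}))) := by
  have hAB : ∀ i j, (fun ω => (A ω, B ω)) ⁻¹' {(i, j)} = A ⁻¹' {i} ∩ B ⁻¹' {j} := by
    intro i j; ext ω; simp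
  have hr : ∀ i, P.real (A ⁻¹' {i}) = ∑ j, P.real (A ⁻¹' {i} ∩ B ⁻¹' {j}) := by
    intro i
    have := measureReal_biUnion_finset (μ := P) (s := Finset.univ)
      (f := fun j => A ⁻¹' {i} ∩ B ⁻¹' {j}) ?_ ?_
    · rw [← this]; congr 1; ext ω; simp
    · intro j _ j' _ hjj
      refine Set.disjoint_left.2 fun ω h h' => hjj ?_
      have h1 := h.2; have h2 := h'.2
      simp at h1 h2; rw [← h1, ← h2]
    · intro j _
      exact (hA (measurableSet_singleton _)).inter (hB (measurableSet_singleton _))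
  have hc : ∀ j, P.real (B ⁻¹' {j}) = ∑ i, P.real (A ⁻¹' {i} ∩ B ⁻¹' {j}) := by
    intro j
    have := measureReal_biUnion_finset (μ := P) (s := Finset.univ)
      (f := fun i => A ⁻¹' {i} ∩ B ⁻¹' {j}) ?_ ?_
    · rw [← this]; congr 1; ext ω; simp
    · intro i _ i' _ hii
      refine Set.disjoint_left.2 fun ω h h' => hii ?_
      have h1 := h.1; have h2 := h'.1
      simp at h1 h2; rw [← h1, ← h2]
    · intro j _
      exact (hA (measurableSet_singleton _)).inter (hB (measurableSet_singleton _))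
  have e1 : shannonEntropy P A = -∑ i, ∑ j, P.real (A ⁻¹' {i} ∩ B ⁻¹' {j}) *
      Real.logb 2 (P.real (A ⁻¹' {i})) := by
    simp only [shannonEntropy]
    congr 1
    refine Finset.sum_congr rfl fun i _ => ?_
    rw [← Finset.sum_mul, ← hr]; rfl
  have e2 : shannonEntropy P B = -∑ i, ∑ j, P.real (A ⁻¹' {i} ∩ B ⁻¹' {j}) *
      Real.logb 2 (P.real (B ⁻¹' {j})) := by
    simp only [shannonEntropy]
    congr 1
    rw [Finset.sum_comm]
    refine Finset.sum_congr rfl fun i _ => ?_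
    rw [← Finset.sum_mul, ← hc]; rfl
  have e3 : shannonEntropy P (fun ω => (A ω, B ω)) = -∑ i, ∑ j, P.real (A ⁻¹' {i} ∩ B ⁻¹' {j}) *
      Real.logb 2 (P.real (A ⁻¹' {i} ∩ B ⁻¹' {j})) := by
    simp only [shannonEntropy]
    rw [Fintype.sum_prod_type]
    simp only [hAB]; rfl
  rw [e1, e2, e3, sub_neg_eq_add, ← neg_add, ← Finset.sum_add_distrib, neg_add_eq_sub,
    ← Finset.sum_sub_distrib]
  refine Finset.sum_congr rfl fun i _ => ?_
  rw [← Finset.sum_add_distrib, ← Finset.sum_sub_distrib]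
  refine Finset.sum_congr rfl fun j _ => ?_
  by_cases h0 : P.real (A ⁻¹' {i} ∩ B ⁻¹' {j}) = 0
  · simp [h0]
  have hpos : 0 < P.real (A ⁻¹' {i} ∩ B ⁻¹' {j}) := measureReal_nonneg.lt_of_ne (Ne.symm h0)
  have h1 : P.real (A ⁻¹' {i}) ≠ 0 :=
    (hpos.trans_le (measureReal_mono inter_subset_left)).ne'
  have h2 : P.real (B ⁻¹' {j}) ≠ 0 :=
    (hpos.trans_le (measureReal_mono inter_subset_right)).ne'
  rw [Real.logb_div h0 (mul_ne_zero h1 h2), Real.logb_mul h1 h2]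
  ring

/-- The finite information bound. -/
lemma info_le {Ω : Type*} [MeasurableSpace Ω] (P : Measure Ω) [IsProbabilityMeasure P]
    {S : Type*} [Fintype S] {n m : ℕ} {a : Ω → Fin n} (ha : Measurable a) (b : S → Fin m)
    {W : Ω → S → ℝ} (hWm : ∀ s, Measurable fun ω => W ω s) (hW0 : ∀ ω s, 0 ≤ W ω s)
    (hW1 : ∀ ω, ∑ s, W ω s = 1) {Q : S → ℝ} (hQ : ∀ s, 0 ≤ Q s) (hQ1 : ∑ s, Q s ≤ 1)
    (hQW : ∀ ω s, Q s = 0 → W ω s = 0)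
    {p : Fin n → Fin m → ℝ} (hp : ∀ i j, p i j = ∑ s, if b s = j then ∫ ω in a ⁻¹' {i}, W ω s ∂P else 0)
    {c : Fin m → ℝ} (hc : ∀ j, c j = ∑ i, p i j) :
    ∑ i, ∑ j, p i j * Real.logb 2 (p i j / (P.real (a ⁻¹' {i}) * c j)) ≤
      ∫ ω, ∑ s, W ω s * Real.logb 2 (W ω s / Q s) ∂P := by
  have hl : 0 < Real.log 2 := Real.log_pos one_lt_two
  have hWle : ∀ ω s, W ω s ≤ 1 := fun ω s => by
    rw [← hW1 ω]; exact Finset.single_le_sum (fun s _ => hW0 ω s) (Finset.mem_univ s)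
  have hWi : ∀ s, Integrable (fun ω => W ω s) P := fun s =>
    Integrable.of_bound (C := 1) (hWm s).aestronglyMeasurable
      (ae_of_all _ fun ω => by rw [Real.norm_of_nonneg (hW0 ω s)]; exact hWle ω s)
  have hci : ∀ s, Integrable (fun ω => W ω s * Real.logb 2 (W ω s / Q s)) P := fun s => by
    refine Integrable.of_bound (C := (1 + |Real.log (Q s)|) / Real.log 2) ?_
      (ae_of_all _ fun ω => by
        rw [Real.norm_eq_abs]; exact abs_cost_le (hW0 ω s) (hWle ω s))
    simp only [Real.logb]
    exact ((hWm s).mul ((Real.measurable_log.comp ((hWm s).div_const _)).div_const _)).aestronglyMeasurable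
  set r : Fin n → ℝ := fun i => P.real (a ⁻¹' {i}) with hr
  set w : Fin n → S → ℝ := fun i s => ∫ ω in a ⁻¹' {i}, W ω s ∂P with hw
  have hms : ∀ i, MeasurableSet (a ⁻¹' {i}) := fun i => ha (measurableSet_singleton i)
  have hw0 : ∀ i s, 0 ≤ w i s := fun i s => setIntegral_nonneg (hms i) fun ω _ => hW0 ω s
  have hp0 : ∀ i j, 0 ≤ p i j := fun i j => by
    rw [hp]; exact Finset.sum_nonneg fun s _ => by
      split_ifs
      · exact hw0 i s
      · exact le_rfl
  have hr0 : ∀ i, 0 ≤ r i := fun i => measureReal_nonneg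
  have hc0 : ∀ j, 0 ≤ c j := fun j => by rw [hc]; exact Finset.sum_nonneg fun i _ => hp0 i j
  have hwp : ∀ i s, w i s ≤ p i (b s) := fun i s => by
    rw [hp]
    have := Finset.single_le_sum (f := fun s' => if b s' = b s then w i s' else 0) (s := Finset.univ)
      (fun s' _ => by split_ifs <;> simp [hw0]) (Finset.mem_univ s)
    simpa using this
  have hwr : ∀ i s, w i s ≤ r i := fun i s => by
    have h := setIntegral_mono_on (hWi s).integrableOn
      (integrable_const (1 : ℝ)).integrableOn (hms i) (fun ω _ => hWle ω s)
    simpa [hw, hr, Measure.real] using h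
  have hpc : ∀ i j, p i j ≤ c j := fun i j => by
    rw [hc]; exact Finset.single_le_sum (f := fun i => p i j) (fun i _ => hp0 i j) (Finset.mem_univ i)
  have part : ∀ g : Ω → ℝ, Integrable g P → ∫ ω, g ω ∂P = ∑ i, ∫ ω in a ⁻¹' {i}, g ω ∂P := by
    intro g hg
    rw [← integral_iUnion_fintype hms ?_ (fun i => hg.integrableOn)]
    · rw [← preimage_iUnion, iUnion_of_singleton, preimage_univ, Measure.restrict_univ]
    · intro i j hij
      exact (Set.disjoint_singleton.2 hij).preimage a
  let κ : Fin n → S → ℝ := fun i s => p i (b s) / (r i * c (b s))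
  -- cell inequality
  have cell : ∀ i s, w i s * Real.logb 2 (κ i s) + (w i s - Q s * κ i s * r i) / Real.log 2 ≤
      ∫ ω in a ⁻¹' {i}, W ω s * Real.logb 2 (W ω s / Q s) ∂P := by
    intro i s
    by_cases hκ : κ i s = 0
    · have hw00 : w i s = 0 := by
        rcases div_eq_zero_iff.1 hκ with h | h
        · exact le_antisymm (h ▸ hwp i s) (hw0 i s)
        · rcases mul_eq_zero.1 h with h | h
          · exact le_antisymm (h ▸ hwr i s) (hw0 i s)
          · exact le_antisymm (h ▸ ((hwp i s).trans (hpc _ _))) (hw0 i s)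
      have hae : (fun ω => W ω s) =ᵐ[P.restrict (a ⁻¹' {i})] 0 :=
        (integral_eq_zero_iff_of_nonneg (fun ω => hW0 ω s) (hWi s).integrableOn).1 hw00
      have : ∫ ω in a ⁻¹' {i}, W ω s * Real.logb 2 (W ω s / Q s) ∂P = 0 := by
        rw [← integral_zero Ω ℝ (μ := P.restrict (a ⁻¹' {i}))]
        refine integral_congr_ae ?_
        filter_upwards [hae] with ω hω
        simp only [Pi.zero_apply] at hω
        simp [hω]
      rw [this, hw00, hκ]; simp
    · have hκ0 : 0 < κ i s :=
        (div_nonneg (hp0 _ _) (mul_nonneg (hr0 _) (hc0 _))).lt_of_ne (Ne.symm hκ)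
      have h := setIntegral_mono_on
        (f := fun ω => W ω s * Real.logb 2 (κ i s) + (W ω s - Q s * κ i s) / Real.log 2)
        ((((hWi s).mul_const _).add (((hWi s).sub (integrable_const _)).div_const _)).integrableOn)
        (hci s).integrableOn (hms i)
        (fun ω _ => tangent_ineq (hW0 ω s) (hQ s) (hQW ω s) hκ0)
      refine le_trans (le_of_eq ?_) h
      have i1 : Integrable (fun ω => W ω s * Real.logb 2 (κ i s)) (P.restrict (a ⁻¹' {i})) :=
        ((hWi s).mul_const _).integrableOn
      have i2 : Integrable (fun ω => W ω s - Q s * κ i s) (P.restrict (a ⁻¹' {i})) :=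
        ((hWi s).sub (integrable_const _)).integrableOn
      rw [integral_add i1 (i2.div_const _), integral_mul_const,
        integral_div, integral_sub (hWi s).integrableOn (integrable_const _).integrableOn,
        integral_const]
      have e : (P.restrict (a ⁻¹' {i})).real univ = r i := by simp [hr, Measure.real]
      rw [e, smul_eq_mul, mul_comm (r i)]
  have hsum : ∫ ω, ∑ s, W ω s * Real.logb 2 (W ω s / Q s) ∂P =
      ∑ i, ∑ s, ∫ ω in a ⁻¹' {i}, W ω s * Real.logb 2 (W ω s / Q s) ∂P := by
    rw [integral_finsetSum _ fun s _ => hci s, Finset.sum_comm]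
    exact Finset.sum_congr rfl fun s _ => part _ (hci s)
  rw [hsum]
  have h1 : ∑ i, ∑ s, w i s = 1 := by
    rw [Finset.sum_comm]
    have : ∀ s, ∑ i, w i s = ∫ ω, W ω s ∂P := fun s => (part _ (hWi s)).symm
    simp_rw [this]
    rw [← integral_finsetSum _ fun s _ => hWi s]
    simp [hW1]
  have h2 : ∑ i, ∑ s, Q s * κ i s * r i ≤ 1 := by
    rw [Finset.sum_comm]
    refine le_trans (Finset.sum_le_sum fun s _ => ?_) hQ1
    have : ∀ i, Q s * κ i s * r i ≤ Q s * (p i (b s) / c (b s)) := by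
      intro i
      rw [mul_assoc]
      refine mul_le_mul_of_nonneg_left ?_ (hQ s)
      rcases (hr0 i).eq_or_lt with h | h
      · rw [← h, mul_zero]; exact div_nonneg (hp0 _ _) (hc0 _)
      · refine le_of_eq ?_
        simp only [κ]
        rw [mul_comm (r i), ← div_div, div_mul_cancel₀ _ h.ne']
    refine (Finset.sum_le_sum fun i _ => this i).trans ?_
    rw [← Finset.mul_sum, ← Finset.sum_div, ← hc]
    exact mul_le_of_le_one_right (hQ s) (div_self_le_one _)
  have h3 : ∑ i, ∑ s, w i s * Real.logb 2 (κ i s) =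
      ∑ i, ∑ j, p i j * Real.logb 2 (p i j / (r i * c j)) := by
    refine Finset.sum_congr rfl fun i _ => ?_
    have : ∀ j, p i j * Real.logb 2 (p i j / (r i * c j)) =
        ∑ s, if b s = j then w i s * Real.logb 2 (κ i s) else 0 := by
      intro j
      have e : p i j * Real.logb 2 (p i j / (r i * c j)) =
        (∑ s, if b s = j then w i s else 0) * Real.logb 2 (p i j / (r i * c j)) :=
        congrArg (· * _) (hp i j)
      rw [e, Finset.sum_mul]
      refine Finset.sum_congr rfl fun s _ => ?_
      split_ifs with h
      · simp only [κ, h]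
      · simp
    simp_rw [this]
    rw [Finset.sum_comm]
    simp
  calc ∑ i, ∑ j, p i j * Real.logb 2 (p i j / (r i * c j))
      ≤ ∑ i, ∑ j, p i j * Real.logb 2 (p i j / (r i * c j)) +
        (1 - ∑ i, ∑ s, Q s * κ i s * r i) / Real.log 2 :=
        le_add_of_nonneg_right (div_nonneg (by linarith) hl.le)
    _ = ∑ i, ∑ s, (w i s * Real.logb 2 (κ i s) + (w i s - Q s * κ i s * r i) / Real.log 2) := by
        simp only [Finset.sum_add_distrib, ← Finset.sum_div, Finset.sum_sub_distrib, h1, h3]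
    _ ≤ _ := Finset.sum_le_sum fun i _ => Finset.sum_le_sum fun s _ => cell i s

end info


section upper

variable {X : Type*} [MetricSpace X] [CompactSpace X] [MeasurableSpace X] [BorelSpace X]
variable {d : ℕ} {T : (Fin d → ℝ) → X → X} {L : ℝ}

lemma shannonEntropy_map_equiv {Ω Ω' S : Type*} [MeasurableSpace Ω] [MeasurableSpace Ω'] [Fintype S]
    (P : Measure Ω) (e : Ω ≃ᵐ Ω') (g : Ω → S) :
    shannonEntropy (P.map e) (fun ω => g (e.symm ω)) = shannonEntropy P g := by
  simp only [shannonEntropy]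
  congr 1
  refine Finset.sum_congr rfl fun i _ => ?_
  have : (P.map e) ((fun ω => g (e.symm ω)) ⁻¹' {i}) = P (g ⁻¹' {i}) := by
    rw [e.map_apply]; congr 1; ext ω; simp
  rw [this]

lemma RL_le_mutualInfo {Ω : Type*} [MeasurableSpace Ω] [StandardBorelSpace Ω] (P : Measure Ω)
    [IsProbabilityMeasure P] {Xv : Ω → X} {Yv : Ω → L1Maps d L X} (hX : Measurable Xv)
    (hY : Measurable Yv) {ε : ℝ} (hε : distortion d T L P Xv Yv < ε) :
    RL d T (P.map Xv) L ε ≤ mutualInfo P Xv Yv := by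
  obtain ⟨g, hg⟩ := exists_measurableEmbedding_real Ω
  let e := hg.equivRange
  have hP : IsProbabilityMeasure (P.map e) := Measure.isProbabilityMeasure_map e.measurable.aemeasurable
  have hmi : mutualInfo (P.map e) (fun ω => Xv (e.symm ω)) (fun ω => Yv (e.symm ω)) =
      mutualInfo P Xv Yv := by
    simp only [mutualInfo]
    refine iSup_congr fun n => iSup_congr fun m => iSup_congr fun α => iSup_congr fun hα =>
      iSup_congr fun β => iSup_congr fun hβ => ?_
    rw [← shannonEntropy_map_equiv P e (fun ω => α (Xv ω)),
      ← shannonEntropy_map_equiv P e (fun ω => β (Yv ω)),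
      ← shannonEntropy_map_equiv P e (fun ω => (α (Xv ω), β (Yv ω)))]
  rw [← hmi, RL]
  refine iInf_le_of_le (range g) <| iInf_le_of_le inferInstance <| iInf_le_of_le (P.map e) <|
    iInf_le_of_le hP <| iInf_le_of_le (fun ω => Xv (e.symm ω)) <|
    iInf_le_of_le (fun ω => Yv (e.symm ω)) <| iInf_le_of_le (hX.comp e.symm.measurable) <|
    iInf_le_of_le (hY.comp e.symm.measurable) <| iInf_le_of_le ?_ <| iInf_le_of_le ?_ le_rfl
  · have h1 : Measurable fun ω => Xv (e.symm ω) := hX.comp e.symm.measurable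
    rw [Measure.map_map h1 e.measurable]
    congr 1
    funext ω; simp
  · refine lt_of_eq_of_lt ?_ hε
    simp only [distortion]
    rw [e.measurableEmbedding.integral_map]
    simp

/-- The measure on `Ω × S` built from a kernel with finitely many labels. -/
noncomputable def labMeasure {Ω S : Type*} [MeasurableSpace Ω] [MeasurableSpace S] [Fintype S]
    (P : Measure Ω) (W : Ω → S → ℝ) : Measure (Ω × S) :=
  ∑ s, (P.withDensity fun ω => ENNReal.ofReal (W ω s)).map (fun ω => (ω, s))

lemma labMeasure_apply {Ω S : Type*} [MeasurableSpace Ω] [MeasurableSpace S] [Fintype S]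
    (P : Measure Ω) (W : Ω → S → ℝ) {E : Set (Ω × S)} (hE : MeasurableSet E) :
    labMeasure P W E = ∑ s, ∫⁻ ω in (fun ω => (ω, s)) ⁻¹' E, ENNReal.ofReal (W ω s) ∂P := by
  rw [labMeasure, Measure.finsetSum_apply]
  refine Finset.sum_congr rfl fun s _ => ?_
  rw [Measure.map_apply measurable_prodMk_right hE,
    withDensity_apply _ (measurable_prodMk_right hE)]

lemma labMeasure_lintegral {Ω S : Type*} [MeasurableSpace Ω] [MeasurableSpace S] [Fintype S]
    (P : Measure Ω) {W : Ω → S → ℝ} (hWm : ∀ s, Measurable fun ω => W ω s)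
    {F : Ω × S → ℝ≥0∞} (hF : Measurable F) :
    ∫⁻ z, F z ∂(labMeasure P W) = ∑ s, ∫⁻ ω, ENNReal.ofReal (W ω s) * F (ω, s) ∂P := by
  rw [labMeasure, lintegral_finsetSum_measure]
  refine Finset.sum_congr rfl fun s _ => ?_
  have h1 : Measurable fun ω => F (ω, s) := hF.comp measurable_prodMk_right
  rw [lintegral_map hF measurable_prodMk_right,
    lintegral_withDensity_eq_lintegral_mul _ (hWm s).ennreal_ofReal h1]
  rfl

lemma RL_le_kernel [Nonempty X] (hT : IsContAction d T) (hL : 0 < L) {Ω : Type*} [MeasurableSpace Ω]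
    [StandardBorelSpace Ω]
    (P : Measure Ω) [IsProbabilityMeasure P] {Z : Ω → X} (hZ : Measurable Z)
    {S : Type*} [Fintype S] (y : S → L1Maps d L X)
    {W : Ω → S → ℝ} (hWm : ∀ s, Measurable fun ω => W ω s) (hW0 : ∀ ω s, 0 ≤ W ω s)
    (hW1 : ∀ ω, ∑ s, W ω s = 1) {Q : S → ℝ} (hQ : ∀ s, 0 ≤ Q s) (hQ1 : ∑ s, Q s ≤ 1)
    (hQW : ∀ ω s, Q s = 0 → W ω s = 0) {ε : ℝ}
    (hε : ∫⁻ ω, ENNReal.ofReal ((L ^ d)⁻¹ * ∑ s, W ω s * Dd d T L (Z ω) (y s)) ∂P < ENNReal.ofReal ε) :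
    RL d T (P.map Z) L ε ≤ ENNReal.ofReal (∫ ω, ∑ s, W ω s * Real.logb 2 (W ω s / Q s) ∂P) := by
  let _ : MeasurableSpace S := ⊤
  have : DiscreteMeasurableSpace S := ⟨fun _ => trivial⟩
  have hWle : ∀ ω s, W ω s ≤ 1 := fun ω s => by
    rw [← hW1 ω]; exact Finset.single_le_sum (fun s _ => hW0 ω s) (Finset.mem_univ s)
  have hWi : ∀ s, Integrable (fun ω => W ω s) P := fun s =>
    Integrable.of_bound (C := 1) (hWm s).aestronglyMeasurable
      (ae_of_all _ fun ω => by rw [Real.norm_of_nonneg (hW0 ω s)]; exact hWle ω s)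
  have hfst : ∀ A : Set Ω, MeasurableSet A → labMeasure P W (Prod.fst ⁻¹' A) = P A := by
    intro A hA
    rw [labMeasure_apply P W (measurable_fst hA)]
    have : ∀ s : S, (fun ω => (ω, s)) ⁻¹' (Prod.fst ⁻¹' A) = A := fun s => rfl
    simp only [this]
    rw [← lintegral_finsetSum _ fun s _ => (hWm s).ennreal_ofReal]
    have : ∀ ω, ∑ s, ENNReal.ofReal (W ω s) = 1 := fun ω => by
      rw [← ENNReal.ofReal_sum_of_nonneg fun s _ => hW0 ω s, hW1, ENNReal.ofReal_one]
    simp [this]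
  have hmapfst : (labMeasure P W).map Prod.fst = P := by
    ext A hA
    rw [Measure.map_apply measurable_fst hA, hfst A hA]
  have hprob : IsProbabilityMeasure (labMeasure P W) := by
    constructor
    have := hfst univ MeasurableSet.univ
    simpa using this
  have hXm : Measurable fun z : Ω × S => Z z.1 := hZ.comp measurable_fst
  have hYm : Measurable fun z : Ω × S => y z.2 := (measurable_of_countable y).comp measurable_snd
  have hmap : (labMeasure P W).map (fun z : Ω × S => Z z.1) = P.map Z := by
    rw [← hmapfst, Measure.map_map hZ measurable_fst, hmapfst]; rfl
  rw [← hmap]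
  have hLd : 0 < L ^ d := pow_pos hL d
  refine (RL_le_mutualInfo (labMeasure P W) hXm hYm ?_).trans ?_
  · -- distortion
    have hDm : Measurable fun z : Ω × S => (L ^ d)⁻¹ * Dd d T L (Z z.1) (y z.2) :=
      (Dd_measurable hT hL.le hXm hYm).const_mul _
    have h0 : ∀ z : Ω × S, 0 ≤ (L ^ d)⁻¹ * Dd d T L (Z z.1) (y z.2) := fun z =>
      mul_nonneg (inv_nonneg.2 hLd.le) (Dd_nonneg _ _)
    have : distortion d T L (labMeasure P W) (fun z => Z z.1) (fun z => y z.2) =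
      ∫ z, (L ^ d)⁻¹ * Dd d T L (Z z.1) (y z.2) ∂(labMeasure P W) := rfl
    rw [this, integral_eq_lintegral_of_nonneg_ae (ae_of_all _ h0) hDm.aestronglyMeasurable]
    have he : ∫⁻ z, ENNReal.ofReal ((L ^ d)⁻¹ * Dd d T L (Z z.1) (y z.2)) ∂(labMeasure P W) =
        ∫⁻ ω, ENNReal.ofReal ((L ^ d)⁻¹ * ∑ s, W ω s * Dd d T L (Z ω) (y s)) ∂P := by
      rw [labMeasure_lintegral P hWm hDm.ennreal_ofReal, ← lintegral_finsetSum]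
      · refine lintegral_congr fun ω => ?_
        rw [Finset.mul_sum, ENNReal.ofReal_sum_of_nonneg]
        · refine Finset.sum_congr rfl fun s _ => ?_
          rw [← ENNReal.ofReal_mul (hW0 ω s)]
          congr 1; ring
        · intro s _
          exact mul_nonneg (inv_nonneg.2 hLd.le) (mul_nonneg (hW0 ω s) (Dd_nonneg _ _))
      · intro s _
        exact (hWm s).ennreal_ofReal.mul (hDm.ennreal_ofReal.comp measurable_prodMk_right)
    rw [he]
    exact ENNReal.toReal_lt_of_lt_ofReal hε
  · -- information
    refine iSup_le fun n => iSup_le fun m => iSup_le fun α => iSup_le fun hα =>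
      iSup_le fun β => iSup_le fun hβ => ?_
    refine ENNReal.ofReal_le_ofReal ?_
    refine (entropy_eq (labMeasure P W) (hα.comp hXm) (hβ.comp hYm)).trans_le ?_
    have ha : Measurable fun ω => α (Z ω) := hα.comp hZ
    have hr : ∀ i, (labMeasure P W).real ((fun z : Ω × S => α (Z z.1)) ⁻¹' {i}) =
        P.real ((fun ω => α (Z ω)) ⁻¹' {i}) := by
      intro i
      simp only [Measure.real]
      congr 1
      exact hfst _ (ha (measurableSet_singleton i))
    have key := info_le P ha (fun s => β (y s)) hWm hW0 hW1 hQ hQ1 hQW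
      (p := fun i j => (labMeasure P W).real ((fun z : Ω × S => α (Z z.1)) ⁻¹' {i} ∩
        (fun z : Ω × S => β (y z.2)) ⁻¹' {j}))
      (c := fun j => (labMeasure P W).real ((fun z : Ω × S => β (y z.2)) ⁻¹' {j})) ?_ ?_
    · simp only [Function.comp_def, hr]
      exact key
    · intro i j
      simp only [Measure.real]
      have hms : MeasurableSet ((fun z : Ω × S => α (Z z.1)) ⁻¹' {i} ∩
          (fun z : Ω × S => β (y z.2)) ⁻¹' {j}) :=
        ((hα.comp hXm) (measurableSet_singleton i)).inter
          ((hβ.comp hYm) (measurableSet_singleton j))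
      rw [labMeasure_apply P W hms]
      rw [ENNReal.toReal_sum]
      · refine Finset.sum_congr rfl fun s _ => ?_
        split_ifs with h
        · have : (fun ω => (ω, s)) ⁻¹' ((fun z : Ω × S => α (Z z.1)) ⁻¹' {i} ∩
            (fun z : Ω × S => β (y z.2)) ⁻¹' {j}) = (fun ω => α (Z ω)) ⁻¹' {i} := by
            ext ω; simp [h]
          rw [this, integral_eq_lintegral_of_nonneg_ae (ae_of_all _ fun ω => hW0 ω s)
            (hWm s).aestronglyMeasurable]
        · have : (fun ω => (ω, s)) ⁻¹' ((fun z : Ω × S => α (Z z.1)) ⁻¹' {i} ∩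
            (fun z : Ω × S => β (y z.2)) ⁻¹' {j}) = ∅ := by
            ext ω; simp [h]
          rw [this]; simp
      · intro s _
        refine ne_of_lt (lt_of_le_of_lt (setLIntegral_le_lintegral _ _) ?_)
        exact (hWi s).lintegral_lt_top
    · intro j
      have := measureReal_biUnion_finset (μ := labMeasure P W) (s := Finset.univ)
        (f := fun i => (fun z : Ω × S => α (Z z.1)) ⁻¹' {i} ∩
          (fun z : Ω × S => β (y z.2)) ⁻¹' {j}) ?_ ?_
      · rw [← this]; congr 1; ext ω; simp
      · intro i _ i' _ hii
        refine Set.disjoint_left.2 fun ω h h' => hii ?_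
        have h1 := h.1; have h2 := h'.1
        simp at h1 h2; rw [← h1, ← h2]
      · intro i _
        exact ((hα.comp hXm) (measurableSet_singleton _)).inter ((hβ.comp hYm) (measurableSet_singleton _))

end upper


/-- A finite-label stochastic code on the box `[0,L)^d` with a reference distribution. -/
structure Code (X : Type*) [MetricSpace X] [MeasurableSpace X] (d : ℕ) (L : ℝ) where
  S : Type
  inst : Fintype S
  y : S → L1Maps d L X
  W : X → S → ℝ
  Q : S → ℝ
  W_meas : ∀ s, Measurable fun x => W x s
  W_nonneg : ∀ x s, 0 ≤ W x s
  W_sum : ∀ x, ∑ s, W x s = 1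
  Q_nonneg : ∀ s, 0 ≤ Q s
  Q_sum : ∑ s, Q s ≤ 1
  QW : ∀ x s, Q s = 0 → W x s = 0

attribute [instance] Code.inst

namespace Code

variable {X : Type*} [MetricSpace X] [MeasurableSpace X] {d : ℕ} {L : ℝ}

/-- The pointwise information cost. -/
noncomputable def cost (C : Code X d L) (x : X) : ℝ :=
  ∑ s, C.W x s * Real.logb 2 (C.W x s / C.Q s)

/-- The pointwise mean distortion. -/
noncomputable def dst (C : Code X d L) (T : (Fin d → ℝ) → X → X) (x : X) : ℝ :=
  (L ^ d)⁻¹ * ∑ s, C.W x s * Dd d T L x (C.y s)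

lemma cost_nonneg (C : Code X d L) (x : X) : 0 ≤ C.cost x := by
  have hl : 0 < Real.log 2 := Real.log_pos one_lt_two
  have h : ∀ s, (C.W x s - C.Q s) / Real.log 2 ≤ C.W x s * Real.logb 2 (C.W x s / C.Q s) := by
    intro s
    have := tangent_ineq (C.W_nonneg x s) (C.Q_nonneg s) (C.QW x s) one_pos
    simpa using this
  refine le_trans ?_ (Finset.sum_le_sum fun s _ => h s)
  rw [← Finset.sum_div, Finset.sum_sub_distrib, C.W_sum]
  exact div_nonneg (by linarith [C.Q_sum]) hl.le

lemma cost_measurable (C : Code X d L) : Measurable C.cost := by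
  unfold cost
  refine Finset.measurable_fun_sum _ fun s _ => ?_
  simp only [Real.logb]
  exact (C.W_meas s).mul ((Real.measurable_log.comp ((C.W_meas s).div_const _)).div_const _)

variable [CompactSpace X] [BorelSpace X] {T : (Fin d → ℝ) → X → X}

lemma dst_nonneg (C : Code X d L) (hL : 0 < L) (x : X) : 0 ≤ C.dst T x :=
  mul_nonneg (inv_nonneg.2 (pow_pos hL d).le)
    (Finset.sum_nonneg fun s _ => mul_nonneg (C.W_nonneg x s) (Dd_nonneg _ _))

lemma dst_measurable (C : Code X d L) (hT : IsContAction d T) : Measurable (C.dst T) := by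
  unfold dst
  refine Measurable.const_mul (Finset.measurable_fun_sum _ fun s _ => ?_) _
  exact (C.W_meas s).mul (Dd_measurable_left hT _)

lemma dst_le (C : Code X d L) (hT : IsContAction d T) (hL : 0 < L) (x : X) :
    C.dst T x ≤ dia X := by
  have hLd := pow_pos hL d
  have : ∑ s, C.W x s * Dd d T L x (C.y s) ≤ ∑ s, C.W x s * (L ^ d * dia X) :=
    Finset.sum_le_sum fun s _ => mul_le_mul_of_nonneg_left (Dd_le hT hL.le _ _) (C.W_nonneg x s)
  rw [← Finset.sum_mul, C.W_sum, one_mul] at this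
  unfold dst
  rw [inv_mul_le_iff₀ hLd]
  exact this

/-- The trivial code. -/
noncomputable def triv (x0 : X) (d : ℕ) (L : ℝ) : Code X d L where
  S := Unit
  inst := inferInstance
  y := fun _ => AEEqFun.const _ x0
  W := fun _ _ => 1
  Q := fun _ => 1
  W_meas := fun _ => measurable_const
  W_nonneg := fun _ _ => zero_le_one
  W_sum := fun _ => by simp
  Q_nonneg := fun _ => zero_le_one
  Q_sum := by simp
  QW := fun _ _ h => absurd h one_ne_zero

lemma triv_cost (x0 x : X) : (triv x0 d L).cost x = 0 := by
  simp [cost, triv]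

end Code

section mix

variable {X : Type*} [MetricSpace X] [CompactSpace X] [MeasurableSpace X] [BorelSpace X]
variable {d : ℕ} {T : (Fin d → ℝ) → X → X} {L : ℝ}

lemma RL_mix [Nonempty X] (hT : IsContAction d T) (hL : 0 < L) {N : ℕ} (C : Fin N → Code X d L)
    (μ : Fin N → Measure X) [hμ : IsProbabilityMeasure (∑ i, μ i)] {ε : ℝ}
    (hε : ∑ i, ∫⁻ x, ENNReal.ofReal ((C i).dst T x) ∂(μ i) < ENNReal.ofReal ε) :
    RL d T (∑ i, μ i) L ε ≤
      ∑ i, ∫⁻ x, ENNReal.ofReal ((C i).cost x + Real.logb 2 N) ∂(μ i) := by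
  classical
  have hN : 0 < N := by
    rcases Nat.eq_zero_or_pos N with rfl | h
    · have := hμ.measure_univ
      simp at this
    · exact h
  have hNr : (0 : ℝ) < N := by exact_mod_cast hN
  let P : Measure (Fin N × X) := ∑ i, (μ i).map (fun x => (i, x))
  have hPl : ∀ F : Fin N × X → ℝ≥0∞, Measurable F → ∫⁻ z, F z ∂P = ∑ i, ∫⁻ x, F (i, x) ∂(μ i) := by
    intro F hF
    simp only [P]
    rw [lintegral_finsetSum_measure]
    refine Finset.sum_congr rfl fun i _ => ?_
    rw [lintegral_map hF measurable_prodMk_left]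
  have hmap : P.map Prod.snd = ∑ i, μ i := by
    ext A hA
    rw [Measure.map_apply measurable_snd hA, Measure.finsetSum_apply, Measure.finsetSum_apply]
    refine Finset.sum_congr rfl fun i _ => ?_
    rw [Measure.map_apply measurable_prodMk_left (measurable_snd hA)]
    rfl
  have hP : IsProbabilityMeasure P := by
    constructor
    have h := hμ.measure_univ
    rw [← hmap, Measure.map_apply measurable_snd MeasurableSet.univ] at h
    simpa using h
  let W : Fin N × X → (Σ i, (C i).S) → ℝ := fun z t => if z.1 = t.1 then (C t.1).W z.2 t.2 else 0
  let Q : (Σ i, (C i).S) → ℝ := fun t => (C t.1).Q t.2 / N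
  let y : (Σ i, (C i).S) → L1Maps d L X := fun t => (C t.1).y t.2
  have hsum : ∀ (G : (Σ i, (C i).S) → ℝ → ℝ) (_ : ∀ t, G t 0 = 0) (i : Fin N) (x : X),
      ∑ t, G t (W (i, x) t) = ∑ s, G ⟨i, s⟩ ((C i).W x s) := by
    intro G hG i x
    rw [Fintype.sum_sigma, Finset.sum_eq_single i]
    · simp [W]
    · intro j _ hj
      refine Finset.sum_eq_zero fun s _ => ?_
      have : W (i, x) ⟨j, s⟩ = 0 := by simp [W, Ne.symm hj]
      rw [this, hG]
    · simp
  have hWm : ∀ t, Measurable fun z => W z t := by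
    intro t
    refine Measurable.ite ?_ (((C t.1).W_meas t.2).comp measurable_snd) measurable_const
    exact measurable_fst (measurableSet_singleton t.1)
  have hF : Measurable fun z : Fin N × X => ∑ t, W z t * Real.logb 2 (W z t / Q t) := by
    refine Finset.measurable_fun_sum _ fun s _ => ?_
    simp only [Real.logb]
    exact (hWm s).mul ((Real.measurable_log.comp ((hWm s).div_const _)).div_const _)
  have hcost : ∀ i x, ∑ t, W (i, x) t * Real.logb 2 (W (i, x) t / Q t) =
      (C i).cost x + Real.logb 2 N := by
    intro i x
    rw [hsum (fun t w => w * Real.logb 2 (w / Q t)) (by simp)]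
    have : Real.logb 2 N = ∑ s, (C i).W x s * Real.logb 2 N := by
      rw [← Finset.sum_mul, (C i).W_sum, one_mul]
    rw [this, Code.cost, ← Finset.sum_add_distrib]
    refine Finset.sum_congr rfl fun s _ => ?_
    by_cases h0 : (C i).W x s = 0
    · simp [h0]
    have hQ0 : (C i).Q s ≠ 0 := fun h => h0 ((C i).QW x s h)
    simp only [Q]
    rw [div_div_eq_mul_div, mul_div_right_comm, Real.logb_mul (div_ne_zero h0 hQ0) hNr.ne']
    ring
  have hdst : ∀ i x, (L ^ d)⁻¹ * ∑ t, W (i, x) t * Dd d T L x (y t) = (C i).dst T x := by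
    intro i x
    rw [hsum (fun t w => w * Dd d T L x (y t)) (by simp)]
    rfl
  have hlogN : 0 ≤ Real.logb 2 N := Real.logb_nonneg one_lt_two (by exact_mod_cast hN)
  have key := RL_le_kernel (T := T) hT hL P (Z := Prod.snd) measurable_snd y (W := W) (Q := Q) (ε := ε)
    hWm ?_ ?_ ?_ ?_ ?_ ?_
  · rw [hmap] at key
    refine key.trans ?_
    rw [integral_eq_lintegral_of_nonneg_ae (ae_of_all _ ?_) hF.aestronglyMeasurable]
    · refine ENNReal.ofReal_toReal_le.trans ?_
      rw [hPl _ hF.ennreal_ofReal]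
      simp only [hcost]
      exact le_rfl
    · rintro ⟨i, x⟩
      simp only [hcost]
      exact add_nonneg ((C i).cost_nonneg x) hlogN
  · intro z t
    simp only [W]
    split_ifs
    · exact (C t.1).W_nonneg _ _
    · exact le_rfl
  · rintro ⟨i, x⟩
    rw [hsum (fun t w => w) (by simp)]
    exact (C i).W_sum x
  · intro t
    exact div_nonneg ((C t.1).Q_nonneg _) hNr.le
  · rw [Fintype.sum_sigma]
    simp only [Q]
    have : ∀ i, ∑ s, (C i).Q s / (N : ℝ) ≤ 1 / N := fun i => by
      rw [← Finset.sum_div]; gcongr; exact (C i).Q_sum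
    refine (Finset.sum_le_sum fun i _ => this i).trans ?_
    simp [hNr.ne']
  · intro z t ht
    simp only [Q, div_eq_zero_iff, hNr.ne', or_false] at ht
    simp only [W, (C t.1).QW z.2 t.2 ht, ite_self]
  · rw [hPl]
    · simp only [hdst]
      exact hε
    · refine Measurable.ennreal_ofReal (Measurable.const_mul (Finset.measurable_fun_sum _ fun t _ => ?_) _)
      exact (hWm t).mul ((Dd_measurable_left hT _).comp measurable_snd)

lemma RL_le_code [Nonempty X] (hT : IsContAction d T) (hL : 0 < L) (C : Code X d L)
    (μ : Measure X) [hμ : IsProbabilityMeasure μ] {ε : ℝ}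
    (hε : ∫⁻ x, ENNReal.ofReal (C.dst T x) ∂μ < ENNReal.ofReal ε) :
    RL d T μ L ε ≤ ∫⁻ x, ENNReal.ofReal (C.cost x) ∂μ := by
  have h1 : ∑ _i : Fin 1, μ = μ := by simp
  have : IsProbabilityMeasure (∑ _i : Fin 1, μ) := by rw [h1]; exact hμ
  have := RL_mix (T := T) hT hL (fun _ : Fin 1 => C) (fun _ => μ) (ε := ε) (by simpa using hε)
  simpa using this

end mix


section discretize

variable {X : Type*} [MetricSpace X] [CompactSpace X] [MeasurableSpace X] [BorelSpace X]
variable {d : ℕ} {T : (Fin d → ℝ) → X → X} {L : ℝ}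

lemma integral_comp_fin {Ω ι : Type*} [MeasurableSpace Ω] [Fintype ι] [MeasurableSpace ι]
    [MeasurableSingletonClass ι] (P : Measure Ω) [IsFiniteMeasure P] {a : Ω → ι} (ha : Measurable a)
    (v : ι → ℝ) : ∫ ω, v (a ω) ∂P = ∑ i, P.real (a ⁻¹' {i}) * v i := by
  rw [← integral_map (f := v) ha.aemeasurable (measurable_of_finite v).aestronglyMeasurable,
    integral_fintype Integrable.of_finite]
  refine Finset.sum_congr rfl fun i _ => ?_
  rw [map_measureReal_apply ha (measurableSet_singleton i), smul_eq_mul]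

/-- Quantisation of the space of maps, seen from finitely many orbits. -/
lemma exists_quant [Nonempty X] (hT : IsContAction d T) (hL : 0 < L) {k : ℕ} (r : Fin k → X) {δ : ℝ}
    (hδ : 0 < δ) : ∃ (m : ℕ) (β : L1Maps d L X → Fin m) (yr : Fin m → L1Maps d L X), Measurable β ∧
      ∀ i y, |Dd d T L (r i) y - Dd d T L (r i) (yr (β y))| ≤ L ^ d * δ := by
  classical
  have hLd := pow_pos hL d
  have hu : 0 < L ^ d * δ := mul_pos hLd hδ
  let G := ⌊L ^ d * dia X / (L ^ d * δ)⌋₊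
  let γ : L1Maps d L X → Fin k → Fin (G + 1) := fun y i =>
    ⟨⌊Dd d T L (r i) y / (L ^ d * δ)⌋₊, Nat.lt_succ_of_le (Nat.floor_mono (by
      have := Dd_le hT hL.le (r i) y
      gcongr))⟩
  have hγ : Measurable γ := by
    refine measurable_pi_lambda _ fun i => ?_
    refine measurable_to_countable' fun j => ?_
    have : (fun y => γ y i) ⁻¹' {j} =
        (fun y => ⌊Dd d T L (r i) y / (L ^ d * δ)⌋₊) ⁻¹' {(j : ℕ)} := by
      ext y; simp [γ, Fin.ext_iff]
    rw [this]
    exact (Nat.measurable_floor.comp ((Dd_measurable_right hT (r i)).div_const _))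
      (measurableSet_singleton _)
  let e := Fintype.equivFin (Fin k → Fin (G + 1))
  let β : L1Maps d L X → Fin (Fintype.card (Fin k → Fin (G + 1))) := fun y => e (γ y)
  let y0 : L1Maps d L X := AEEqFun.const _ (Classical.arbitrary X)
  let yr : Fin (Fintype.card (Fin k → Fin (G + 1))) → L1Maps d L X := fun j =>
    if h : ∃ y, β y = j then h.choose else y0
  refine ⟨_, β, yr, (measurable_of_finite e).comp hγ, fun i y => ?_⟩
  have hex : ∃ y', β y' = β y := ⟨y, rfl⟩
  have h1 : β (yr (β y)) = β y := by
    simp only [yr, dif_pos hex]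
    exact hex.choose_spec
  have h2 : γ (yr (β y)) = γ y := e.injective h1
  have h3 := congrArg Fin.val (congrFun h2 i)
  simp only [γ] at h3
  have n1 : 0 ≤ Dd d T L (r i) y / (L ^ d * δ) := div_nonneg (Dd_nonneg _ _) hu.le
  have n2 : 0 ≤ Dd d T L (r i) (yr (β y)) / (L ^ d * δ) := div_nonneg (Dd_nonneg _ _) hu.le
  have a1 := Nat.floor_le n1
  have a2 := Nat.floor_le n2
  have b1 := Nat.lt_floor_add_one (Dd d T L (r i) y / (L ^ d * δ))
  have b2 := Nat.lt_floor_add_one (Dd d T L (r i) (yr (β y)) / (L ^ d * δ))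
  rw [h3] at a2 b2
  rw [le_div_iff₀ hu] at a1 a2
  rw [div_lt_iff₀ hu] at b1 b2
  rw [abs_le]
  constructor <;> linarith

/-- A code whose cost and distortion are controlled by vectors on the cells of a partition. -/
def CodeAdapted (T : (Fin d → ℝ) → X → X) {k : ℕ} (α : X → Fin k) (δ : ℝ) (C : Code X d L)
    (cv dv : Fin k → ℝ) : Prop :=
  (∀ x, C.cost x = cv (α x)) ∧ ∀ x, C.dst T x ≤ dv (α x) + δ

lemma exists_adapted [Nonempty X] (hT : IsContAction d T) (hL : 0 < L) {k : ℕ} {α : X → Fin k}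
    (hα : Measurable α) {r : Fin k → X} {δ : ℝ} (hδ : 0 < δ)
    (hr : ∀ x, ∀ u ∈ unitBox d L, dist (T u x) (T u (r (α x))) ≤ δ)
    (ν : Measure X) [IsProbabilityMeasure ν] {ε : ℝ} {c : ℝ≥0∞} (h : RL d T ν L ε < c) :
    ∃ (C : Code X d L) (cv dv : Fin k → ℝ), CodeAdapted T α δ C cv dv ∧
      ENNReal.ofReal (∑ i, ν.real (α ⁻¹' {i}) * cv i) < c ∧
      ∑ i, ν.real (α ⁻¹' {i}) * dv i < ε + 2 * δ := by
  classical
  simp only [RL, iInf_lt_iff] at h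
  obtain ⟨Ω, _, P, hP, Xv, Yv, hX, hY, hmap, hdist, hc⟩ := h
  have hLd := pow_pos hL d
  obtain ⟨m, β, yr, hβ, hyr⟩ := exists_quant hT hL r hδ
  have ha : Measurable fun ω => α (Xv ω) := hα.comp hX
  have hb : Measurable fun ω => β (Yv ω) := hβ.comp hY
  set a := fun ω => α (Xv ω) with hadef
  set b := fun ω => β (Yv ω) with hbdef
  let p : Fin k → Fin m → ℝ := fun i j => P.real (a ⁻¹' {i} ∩ b ⁻¹' {j})
  let ρ : Fin k → ℝ := fun i => P.real (a ⁻¹' {i})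
  let Q : Fin m → ℝ := fun j => P.real (b ⁻¹' {j})
  have hρν : ∀ i, ν.real (α ⁻¹' {i}) = ρ i := by
    intro i
    rw [← hmap, map_measureReal_apply hX (hα (measurableSet_singleton i))]
    rfl
  have hQsum : ∑ j, Q j = 1 := by
    have := integral_comp_fin P hb (fun _ => 1)
    simpa using this.symm
  have hpsum : ∀ i, ∑ j, p i j = ρ i := by
    intro i
    have := measureReal_biUnion_finset (μ := P) (s := Finset.univ)
      (f := fun j => a ⁻¹' {i} ∩ b ⁻¹' {j}) ?_ ?_
    · simp only [p, ρ]; rw [← this]; congr 1; ext ω; simp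
    · intro j _ j' _ hjj
      refine Set.disjoint_left.2 fun ω h h' => hjj ?_
      have h1 := h.2; have h2 := h'.2
      simp only [mem_preimage, mem_singleton_iff] at h1 h2; rw [← h1, ← h2]
    · intro j _
      exact (ha (measurableSet_singleton _)).inter (hb (measurableSet_singleton _))
  have hp0 : ∀ i j, 0 ≤ p i j := fun i j => measureReal_nonneg
  have hpρ : ∀ i j, p i j ≤ ρ i := fun i j => measureReal_mono inter_subset_left
  have hpQ : ∀ i j, p i j ≤ Q j := fun i j => measureReal_mono inter_subset_right
  let w : Fin k → Fin m → ℝ := fun i j => if ρ i = 0 then Q j else p i j / ρ i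
  have hρw : ∀ i j, ρ i * w i j = p i j := by
    intro i j
    by_cases h0 : ρ i = 0
    · rw [h0, zero_mul]; exact le_antisymm (hp0 i j) (h0 ▸ hpρ i j)
    · simp only [w, h0, if_false]; field_simp
  have hw0 : ∀ i j, 0 ≤ w i j := by
    intro i j
    simp only [w]
    split_ifs
    · exact measureReal_nonneg
    · exact div_nonneg (hp0 _ _) measureReal_nonneg
  have hw1 : ∀ i, ∑ j, w i j = 1 := by
    intro i
    by_cases h0 : ρ i = 0
    · simp only [w, h0, if_true]; exact hQsum
    · simp only [w, h0, if_false]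
      rw [← Finset.sum_div, hpsum, div_self h0]
  let C : Code X d L :=
    { S := Fin m
      inst := inferInstance
      y := yr
      W := fun x s => w (α x) s
      Q := Q
      W_meas := fun s => (measurable_of_finite fun i => w i s).comp hα
      W_nonneg := fun x s => hw0 _ _
      W_sum := fun x => hw1 _
      Q_nonneg := fun s => measureReal_nonneg
      Q_sum := hQsum.le
      QW := by
        intro x s hs
        simp only [w]
        split_ifs
        · exact hs
        · rw [le_antisymm (hs ▸ hpQ (α x) s) (hp0 _ _), zero_div] }
  refine ⟨C, fun i => ∑ j, w i j * Real.logb 2 (w i j / Q j),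
    fun i => (L ^ d)⁻¹ * ∑ j, w i j * Dd d T L (r i) (yr j), ⟨fun x => rfl, fun x => ?_⟩, ?_, ?_⟩
  · have h1 : ∀ j, w (α x) j * Dd d T L x (yr j) ≤
        w (α x) j * Dd d T L (r (α x)) (yr j) + w (α x) j * (L ^ d * δ) := by
      intro j
      rw [← mul_add]
      refine mul_le_mul_of_nonneg_left ?_ (hw0 _ _)
      have := (abs_le.1 (Dd_close hT hL.le (hr x) (yr j))).2
      linarith
    have h2 := Finset.sum_le_sum fun j (_ : j ∈ Finset.univ) => h1 j
    rw [Finset.sum_add_distrib, ← Finset.sum_mul, hw1, one_mul] at h2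
    have h3 := mul_le_mul_of_nonneg_left h2 (inv_nonneg.2 hLd.le)
    rw [mul_add, inv_mul_cancel_left₀ hLd.ne'] at h3
    exact h3
  · refine lt_of_le_of_lt ?_ hc
    have : ∑ i, ν.real (α ⁻¹' {i}) * ∑ j, w i j * Real.logb 2 (w i j / Q j) =
        shannonEntropy P a + shannonEntropy P b - shannonEntropy P (fun ω => (a ω, b ω)) := by
      rw [entropy_eq P ha hb]
      refine Finset.sum_congr rfl fun i _ => ?_
      rw [hρν, Finset.mul_sum]
      refine Finset.sum_congr rfl fun j _ => ?_
      rw [← mul_assoc, hρw]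
      by_cases h0 : ρ i = 0
      · have : p i j = 0 := le_antisymm (h0 ▸ hpρ i j) (hp0 i j)
        change p i j * _ = p i j * _
        rw [this, zero_mul, zero_mul]
      · simp only [w, h0, if_false]
        rw [div_div]
    rw [this, mutualInfo]
    exact le_iSup_of_le k <| le_iSup_of_le m <| le_iSup_of_le α <| le_iSup_of_le hα <|
      le_iSup_of_le β <| le_iSup_of_le hβ le_rfl
  · have h1 : ∑ i, ν.real (α ⁻¹' {i}) * ((L ^ d)⁻¹ * ∑ j, w i j * Dd d T L (r i) (yr j)) =
        ∫ ω, (L ^ d)⁻¹ * Dd d T L (r (a ω)) (yr (b ω)) ∂P := by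
      rw [integral_comp_fin P (ha.prodMk hb)
        (fun z : Fin k × Fin m => (L ^ d)⁻¹ * Dd d T L (r z.1) (yr z.2)), Fintype.sum_prod_type]
      refine Finset.sum_congr rfl fun i _ => ?_
      rw [hρν, Finset.mul_sum, Finset.mul_sum]
      refine Finset.sum_congr rfl fun j _ => ?_
      have : P.real ((fun ω => (a ω, b ω)) ⁻¹' {(i, j)}) = p i j := by
        simp only [p]; congr 1; ext ω; simp
      rw [this, ← hρw]; ring
    rw [h1]
    have hDm : Measurable fun ω => Dd d T L (Xv ω) (Yv ω) := Dd_measurable hT hL.le hX hY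
    have hDi : Integrable (fun ω => Dd d T L (Xv ω) (Yv ω)) P :=
      Integrable.of_bound (C := L ^ d * dia X) hDm.aestronglyMeasurable (ae_of_all _ fun ω => by
        rw [Real.norm_of_nonneg (Dd_nonneg _ _)]; exact Dd_le hT hL.le _ _)
    have hDm' : Measurable fun ω => Dd d T L (r (a ω)) (yr (b ω)) :=
      (measurable_of_finite fun z : Fin k × Fin m => Dd d T L (r z.1) (yr z.2)).comp (ha.prodMk hb)
    have hDi' : Integrable (fun ω => Dd d T L (r (a ω)) (yr (b ω))) P :=
      Integrable.of_bound (C := L ^ d * dia X) hDm'.aestronglyMeasurable (ae_of_all _ fun ω => by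
        rw [Real.norm_of_nonneg (Dd_nonneg _ _)]; exact Dd_le hT hL.le _ _)
    have h2 : ∫ ω, (L ^ d)⁻¹ * Dd d T L (r (a ω)) (yr (b ω)) ∂P ≤
        ∫ ω, ((L ^ d)⁻¹ * Dd d T L (Xv ω) (Yv ω) + 2 * δ) ∂P := by
      refine integral_mono (hDi'.const_mul _) ((hDi.const_mul _).add (integrable_const _)) fun ω => ?_
      have e1 := (abs_le.1 (Dd_close hT hL.le (hr (Xv ω)) (Yv ω))).1
      have e2 := (abs_le.1 (hyr (a ω) (Yv ω))).1
      have e3 : Dd d T L (r (a ω)) (yr (b ω)) ≤ Dd d T L (Xv ω) (Yv ω) + L ^ d * (2 * δ) := by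
        have : Dd d T L (r (α (Xv ω))) (Yv ω) = Dd d T L (r (a ω)) (Yv ω) := rfl
        have : Dd d T L (r (a ω)) (yr (β (Yv ω))) = Dd d T L (r (a ω)) (yr (b ω)) := rfl
        linarith
      have h3 := mul_le_mul_of_nonneg_left e3 (inv_nonneg.2 hLd.le)
      rw [mul_add, inv_mul_cancel_left₀ hLd.ne'] at h3
      exact h3
    rw [integral_add (hDi.const_mul _) (integrable_const _)] at h2
    have h4 : ∫ ω, (L ^ d)⁻¹ * Dd d T L (Xv ω) (Yv ω) ∂P < ε := hdist
    have h5 : ∫ _ω : Ω, 2 * δ ∂P = 2 * δ := by simp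
    linarith

/-- A countable family of codes, good up to `3δ` in the distortion. -/
lemma exists_countable_codes_aux [Nonempty X] (hT : IsContAction d T) (hL : 0 < L) {δ : ℝ}
    (hδ : 0 < δ) : ∃ K : Set (Code X d L), K.Countable ∧
      ∀ (ν : Measure X) [IsProbabilityMeasure ν] (ε : ℝ) (c : ℝ≥0∞), RL d T ν L ε < c →
        ∃ C ∈ K, ∫⁻ x, ENNReal.ofReal (C.cost x) ∂ν < c ∧
          ∫⁻ x, ENNReal.ofReal (C.dst T x) ∂ν < ENNReal.ofReal (ε + 3 * δ) := by
  obtain ⟨k, α, r, hα, hr⟩ := exists_partition hT L hδ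
  let V : Set ((Fin k → ℝ) × (Fin k → ℝ)) := {v | ∃ C : Code X d L, CodeAdapted T α δ C v.1 v.2}
  obtain ⟨t, htV, htc, hVt⟩ :=
    (TopologicalSpace.IsSeparable.of_separableSpace V).exists_countable_dense_subset
  have hch : ∀ v : t, ∃ C : Code X d L, CodeAdapted T α δ C v.1.1 v.1.2 := fun v => htV v.2
  choose F hF using hch
  have := htc.to_subtype
  refine ⟨range F, countable_range F, fun ν hν ε c h => ?_⟩
  obtain ⟨C, cv, dv, hC, h1, h2⟩ := exists_adapted hT hL hα hδ hr ν h
  let U : Set ((Fin k → ℝ) × (Fin k → ℝ)) :=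
    {v | ENNReal.ofReal (∑ i, ν.real (α ⁻¹' {i}) * v.1 i) < c ∧
      ∑ i, ν.real (α ⁻¹' {i}) * v.2 i < ε + 2 * δ}
  have hU : IsOpen U := by
    have e1 : IsOpen {v : (Fin k → ℝ) × (Fin k → ℝ) |
        ENNReal.ofReal (∑ i, ν.real (α ⁻¹' {i}) * v.1 i) < c} :=
      isOpen_lt (ENNReal.continuous_ofReal.comp (by fun_prop)) continuous_const
    have e2 : IsOpen {v : (Fin k → ℝ) × (Fin k → ℝ) |
        ∑ i, ν.real (α ⁻¹' {i}) * v.2 i < ε + 2 * δ} :=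
      isOpen_lt (by fun_prop) continuous_const
    exact e1.inter e2
  obtain ⟨v, hvU, hvt⟩ := mem_closure_iff.1 (hVt (show (cv, dv) ∈ V from ⟨C, hC⟩)) U hU ⟨h1, h2⟩
  refine ⟨F ⟨v, hvt⟩, mem_range_self _, ?_, ?_⟩
  · have hcost := (hF ⟨v, hvt⟩).1
    set C' := F ⟨v, hvt⟩
    have hi : Integrable (fun x => v.1 (α x)) ν :=
      (Integrable.of_finite (μ := ν.map α) (f := v.1)).comp_measurable hα
    have : ∫⁻ x, ENNReal.ofReal (C'.cost x) ∂ν =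
        ENNReal.ofReal (∑ i, ν.real (α ⁻¹' {i}) * v.1 i) := by
      rw [← integral_comp_fin ν hα, ofReal_integral_eq_lintegral_ofReal hi]
      · simp only [hcost]
      · refine ae_of_all _ fun x => ?_
        simp only [Pi.zero_apply]
        rw [← hcost]; exact C'.cost_nonneg x
    rw [this]; exact hvU.1
  · have hd := (hF ⟨v, hvt⟩).2
    set C' := F ⟨v, hvt⟩
    have hi0 : Integrable (fun x => v.2 (α x)) ν :=
      (Integrable.of_finite (μ := ν.map α) (f := v.2)).comp_measurable hα
    have hi : Integrable (fun x => v.2 (α x) + δ) ν := hi0.add (integrable_const _)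
    have h0 : ∀ x, 0 ≤ v.2 (α x) + δ := fun x => (C'.dst_nonneg hL x).trans (hd x)
    calc ∫⁻ x, ENNReal.ofReal (C'.dst T x) ∂ν
        ≤ ∫⁻ x, ENNReal.ofReal (v.2 (α x) + δ) ∂ν :=
          lintegral_mono fun x => ENNReal.ofReal_le_ofReal (hd x)
      _ = ENNReal.ofReal (∫ x, (v.2 (α x) + δ) ∂ν) :=
          (ofReal_integral_eq_lintegral_ofReal hi (ae_of_all _ h0)).symm
      _ < ENNReal.ofReal (ε + 3 * δ) := by
          rw [ENNReal.ofReal_lt_ofReal_iff_of_nonneg (integral_nonneg h0),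
            integral_add hi0 (integrable_const _), integral_comp_fin ν hα]
          have := hvU.2
          simp only [integral_const, probReal_univ, one_smul]
          linarith

/-- A countable family of codes realising all values of `RL`. -/
lemma exists_countable_codes [Nonempty X] (hT : IsContAction d T) (hL : 0 < L) :
    ∃ K : Set (Code X d L), K.Countable ∧
      ∀ (ν : Measure X) [IsProbabilityMeasure ν] (ε : ℝ) (c : ℝ≥0∞), RL d T ν L ε < c →
        ∃ C ∈ K, ∫⁻ x, ENNReal.ofReal (C.cost x) ∂ν < c ∧
          ∫⁻ x, ENNReal.ofReal (C.dst T x) ∂ν < ENNReal.ofReal ε := by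
  have hpos : ∀ n : ℕ, (0 : ℝ) < 1 / ((n : ℝ) + 1) := fun n => by positivity
  choose K hK hK' using fun n : ℕ => exists_countable_codes_aux (X := X) hT hL (hpos n)
  refine ⟨⋃ n, K n, countable_iUnion hK, fun ν hν ε c h => ?_⟩
  obtain ⟨ε', hε', h'⟩ : ∃ ε' < ε, RL d T ν L ε' < c := by
    simp only [RL, iInf_lt_iff] at h
    obtain ⟨Ω, i1, P, hP, Xv, Yv, hX, hY, hmap, hdist, hc⟩ := h
    obtain ⟨ε', h1, h2⟩ := exists_between hdist
    refine ⟨ε', h2, ?_⟩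
    simp only [RL, iInf_lt_iff]
    exact ⟨Ω, i1, P, hP, Xv, Yv, hX, hY, hmap, h1, hc⟩
  obtain ⟨n, hn⟩ := exists_nat_one_div_lt (show (0 : ℝ) < (ε - ε') / 3 by linarith)
  obtain ⟨C, hC, h1, h2⟩ := hK' n ν ε' c h'
  refine ⟨C, mem_iUnion.2 ⟨n, hC⟩, h1, h2.trans_le (ENNReal.ofReal_le_ofReal ?_)⟩
  linarith

end discretize


section block

lemma sum_prod_eq_one {I S : Type*} [Fintype I] [DecidableEq I] [Fintype S] (p : I → S → ℝ)
    (h : ∀ t, ∑ a, p t a = 1) : ∑ s : I → S, ∏ t, p t (s t) = 1 := by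
  have := Finset.prod_univ_sum (fun _ : I => (Finset.univ : Finset S)) p
  rw [Fintype.piFinset_univ] at this
  rw [← this]
  exact Finset.prod_eq_one fun t _ => h t

lemma sum_prod_marginal {I S : Type*} [Fintype I] [DecidableEq I] [Fintype S] (p : I → S → ℝ)
    (h : ∀ t, ∑ a, p t a = 1) (t : I) (g : S → ℝ) :
    ∑ s : I → S, (∏ r, p r (s r)) * g (s t) = ∑ a, p t a * g a := by
  have := Finset.prod_univ_sum (fun _ : I => (Finset.univ : Finset S))
    (fun r a => p r a * if r = t then g a else 1)
  rw [Fintype.piFinset_univ] at this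
  have h2 : ∀ s : I → S, ∏ r, (p r (s r) * if r = t then g (s r) else 1) =
      (∏ r, p r (s r)) * g (s t) := by
    intro s
    rw [Finset.prod_mul_distrib, Finset.prod_ite_eq' Finset.univ t (fun r => g (s r))]
    simp
  simp only [h2] at this
  rw [← this, Finset.prod_eq_single t]
  · simp
  · intro r _ hr
    simp [hr, h]
  · simp

variable {X : Type*} [MetricSpace X] [CompactSpace X] [MeasurableSpace X] [BorelSpace X]
variable {d : ℕ} {T : (Fin d → ℝ) → X → X} {L : ℝ}

/-- Lattice offsets. -/
noncomputable def off {k : ℕ} (L : ℝ) (t : Fin d → Fin k) : Fin d → ℝ := fun i => L * ((t i : ℕ) : ℝ)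

/-- Lattice index of a point, clipped. -/
noncomputable def latIdx {k : ℕ} (hk : 0 < k) (L : ℝ) (u : Fin d → ℝ) : Fin d → Fin k := fun i =>
  ⟨min ⌊u i / L⌋₊ (k - 1), by omega⟩

lemma latIdx_measurable {k : ℕ} (hk : 0 < k) (L : ℝ) :
    Measurable (latIdx (d := d) hk L) := by
  refine measurable_pi_lambda _ fun i => ?_
  have h : Measurable fun u : Fin d → ℝ => ⌊u i / L⌋₊ :=
    Nat.measurable_floor.comp ((measurable_pi_apply i).div_const _)
  exact (measurable_from_nat (f := fun n : ℕ => (⟨min n (k - 1), by omega⟩ : Fin k))).comp h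

/-- Lattice cell. -/
noncomputable def latCell {k : ℕ} (L : ℝ) (t : Fin d → Fin k) : Set (Fin d → ℝ) :=
  (fun u => u - off L t) ⁻¹' unitBox d L

lemma latIdx_eq {k : ℕ} (hk : 0 < k) (hL : 0 < L) (t : Fin d → Fin k) {u : Fin d → ℝ}
    (hu : u ∈ latCell L t) : latIdx hk L u = t := by
  funext i
  have h := hu i (mem_univ i)
  simp only [off, Pi.sub_apply, mem_Ico] at h
  have : ⌊u i / L⌋₊ = (t i : ℕ) := by
    have h0 : 0 ≤ u i / L := by
      apply div_nonneg _ hL.le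
      have : 0 ≤ L * ((t i : ℕ) : ℝ) := by positivity
      linarith
    rw [Nat.floor_eq_iff h0, le_div_iff₀ hL, div_lt_iff₀ hL]
    constructor <;> linarith
  apply Fin.ext
  simp only [latIdx, this]
  have := (t i).2
  omega

lemma latCell_subset {k : ℕ} (hL : 0 < L) {M : ℝ} (hM : k * L ≤ M) (t : Fin d → Fin k) :
    latCell L t ⊆ unitBox d M := by
  intro u hu i hi
  have h := hu i hi
  simp only [off, Pi.sub_apply, mem_Ico] at h ⊢
  have h1 : 0 ≤ L * ((t i : ℕ) : ℝ) := by positivity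
  have h2 : ((t i : ℕ) : ℝ) + 1 ≤ k := by exact_mod_cast (t i).2
  have h3 := mul_le_mul_of_nonneg_left h2 hL.le
  constructor <;> linarith

lemma latCell_measurable {k : ℕ} (L : ℝ) (t : Fin d → Fin k) : MeasurableSet (latCell L t) :=
  (measurableSet_unitBox d L).preimage (measurable_id.sub_const _)

lemma latCell_disjoint {k : ℕ} (hk : 0 < k) (hL : 0 < L) :
    Pairwise (Function.onFun Disjoint (latCell (d := d) (k := k) L)) := by
  intro t t' h
  refine Set.disjoint_left.2 fun u hu hu' => h ?_
  rw [← latIdx_eq hk hL t hu, latIdx_eq hk hL t' hu']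

lemma latCell_volume {k : ℕ} (t : Fin d → Fin k) :
    volume (latCell L t) = ENNReal.ofReal L ^ d := by
  rw [← volume_unitBox]
  exact (measurePreserving_sub_right volume (off L t)).measure_preimage
    (measurableSet_unitBox d L).nullMeasurableSet

/-- The pasted map. -/
noncomputable def paste {S : Type} {k : ℕ} (hk : 0 < k) (y : S → L1Maps d L X)
    (s : (Fin d → Fin k) → S) (u : Fin d → ℝ) : X :=
  y (s (latIdx hk L u)) (u - off L (latIdx hk L u))

lemma paste_measurable {S : Type} {k : ℕ} (hk : 0 < k) (y : S → L1Maps d L X)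
    (s : (Fin d → Fin k) → S) : Measurable (paste hk y s) := by
  have h : Measurable fun z : (Fin d → Fin k) × (Fin d → ℝ) => y (s z.1) (z.2 - off L z.1) := by
    refine measurable_from_prod_countable_right fun t => ?_
    exact (y (s t)).stronglyMeasurable.measurable.comp (measurable_id.sub_const (off L t))
  exact h.comp ((latIdx_measurable hk L).prodMk measurable_id)

lemma Dd_paste (hT : IsContAction d T) {S : Type} {k : ℕ} (hk : 0 < k) (hL : 0 < L) {M : ℝ}
    (hM : k * L ≤ M) (y : S → L1Maps d L X) (s : (Fin d → Fin k) → S) (x : X) :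
    Dd d T M x (AEEqFun.mk (paste hk y s) (paste_measurable hk y s).aestronglyMeasurable) ≤
      ∑ t, Dd d T L (T (off L t) x) (y (s t)) + dia X * (M ^ d - (k * L) ^ d) := by
  have hM0 : 0 ≤ M := le_trans (by positivity) hM
  have e1 : Dd d T M x (AEEqFun.mk (paste hk y s) (paste_measurable hk y s).aestronglyMeasurable) =
      ∫ u in unitBox d M, dist (T u x) (paste hk y s u) := by
    refine integral_congr_ae ?_
    filter_upwards [AEEqFun.coeFn_mk (μ := boxMeasure d M) (paste hk y s)
      (paste_measurable hk y s).aestronglyMeasurable] with u hu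
    rw [hu]
  have hint : IntegrableOn (fun u => dist (T u x) (paste hk y s u)) (unitBox d M) := by
    have : IsFiniteMeasure (volume.restrict (unitBox d M)) := boxMeasure_finite d M
    exact Dd_integrable_of hT x (paste_measurable hk y s).aestronglyMeasurable
  have hUsub : (⋃ t, latCell (k := k) L t) ⊆ unitBox d M :=
    iUnion_subset fun t => latCell_subset hL hM t
  have hUm : MeasurableSet (⋃ t, latCell (d := d) (k := k) L t) :=
    MeasurableSet.iUnion fun t => latCell_measurable L t
  have e2 : ∫ u in unitBox d M, dist (T u x) (paste hk y s u) =
      (∫ u in ⋃ t, latCell (k := k) L t, dist (T u x) (paste hk y s u)) +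
      ∫ u in unitBox d M \ ⋃ t, latCell (k := k) L t, dist (T u x) (paste hk y s u) := by
    rw [← setIntegral_union disjoint_sdiff_right ((measurableSet_unitBox d M).diff hUm)
      (hint.mono_set hUsub) (hint.mono_set sdiff_subset), union_sdiff_cancel hUsub]
  have e3 : ∫ u in ⋃ t, latCell (k := k) L t, dist (T u x) (paste hk y s u) =
      ∑ t, Dd d T L (T (off L t) x) (y (s t)) := by
    rw [integral_iUnion_fintype (fun t => latCell_measurable L t) (latCell_disjoint hk hL)
      (fun t => hint.mono_set (latCell_subset hL hM t))]
    refine Finset.sum_congr rfl fun t _ => ?_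
    have hDd : Dd d T L (T (off L t) x) (y (s t)) =
      ∫ v in unitBox d L, dist (T v (T (off L t) x)) (y (s t) v) := rfl
    have hpre := (measurePreserving_sub_right volume (off L t)).setIntegral_preimage_emb
      (measurableEmbedding_subRight _) (fun v => dist (T v (T (off L t) x)) (y (s t) v)) (unitBox d L)
    rw [hDd, ← hpre]
    refine setIntegral_congr_fun (latCell_measurable L t) fun u hu => ?_
    simp only [paste, latIdx_eq hk hL t hu]
    rw [← hT.2.2, sub_add_cancel]
  have hUvol : volume (⋃ t, latCell (d := d) (k := k) L t) = ENNReal.ofReal ((k * L) ^ d) := by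
    rw [measure_iUnion (latCell_disjoint hk hL) (fun t => latCell_measurable L t), tsum_fintype]
    simp only [latCell_volume, Finset.sum_const, Finset.card_univ, Fintype.card_pi, Fintype.card_fin,
      Finset.prod_const, nsmul_eq_mul]
    rw [ENNReal.ofReal_pow (by positivity), ENNReal.ofReal_mul (by positivity), mul_pow]
    simp
  have e4 : ∫ u in unitBox d M \ ⋃ t, latCell (k := k) L t, dist (T u x) (paste hk y s u) ≤
      dia X * (M ^ d - (k * L) ^ d) := by
    have hr : volume.real (unitBox d M \ ⋃ t, latCell (k := k) L t) = M ^ d - (k * L) ^ d := by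
      rw [measureReal_sdiff hUsub hUm (by
        rw [volume_unitBox]; exact ENNReal.pow_ne_top ENNReal.ofReal_ne_top)]
      rw [Measure.real, Measure.real, hUvol, volume_unitBox, ENNReal.toReal_ofReal (by positivity),
        ENNReal.toReal_pow, ENNReal.toReal_ofReal hM0]
    rw [← hr]
    have hfin : volume (unitBox d M \ ⋃ t, latCell (k := k) L t) < ⊤ := by
      refine lt_of_le_of_lt (measure_mono sdiff_subset) ?_
      rw [volume_unitBox]; exact ENNReal.pow_lt_top ENNReal.ofReal_lt_top
    refine (le_abs_self _).trans ?_
    exact norm_setIntegral_le_of_norm_le_const (C := dia X)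
      (f := fun u => dist (T u x) (paste hk y s u)) hfin fun u _ => by
      rw [Real.norm_of_nonneg dist_nonneg]
      exact dist_le_dia _ _
  rw [e1, e2, e3]
  linarith

/-- Block code. -/
noncomputable def Code.block (C : Code X d L) (hT : IsContAction d T) {k : ℕ} (hk : 0 < k) (M : ℝ) :
    Code X d M where
  S := (Fin d → Fin k) → C.S
  inst := inferInstance
  y := fun s => AEEqFun.mk (paste hk C.y s) (paste_measurable hk C.y s).aestronglyMeasurable
  W := fun x s => ∏ t, C.W (T (off L t) x) (s t)
  Q := fun s => ∏ t, C.Q (s t)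
  W_meas := fun s => Finset.measurable_fun_prod _ fun t _ =>
    (C.W_meas (s t)).comp (hT.cont_right _).measurable
  W_nonneg := fun x s => Finset.prod_nonneg fun t _ => C.W_nonneg _ _
  W_sum := fun x => sum_prod_eq_one (fun t a => C.W (T (off L t) x) a) fun t => C.W_sum _
  Q_nonneg := fun s => Finset.prod_nonneg fun t _ => C.Q_nonneg _
  Q_sum := by
    have := Finset.prod_univ_sum (fun _ : Fin d → Fin k => (Finset.univ : Finset C.S))
      (fun _ a => C.Q a)
    rw [Fintype.piFinset_univ] at this
    rw [← this]
    exact Finset.prod_le_one (fun t _ => Finset.sum_nonneg fun a _ => C.Q_nonneg a)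
      fun t _ => C.Q_sum
  QW := by
    intro x s h
    obtain ⟨t, ht, h0⟩ := Finset.prod_eq_zero_iff.1 h
    exact Finset.prod_eq_zero ht (C.QW _ _ h0)

lemma Code.block_cost (C : Code X d L) (hT : IsContAction d T) {k : ℕ} (hk : 0 < k) (M : ℝ) (x : X) :
    (C.block hT hk M).cost x = ∑ t : Fin d → Fin k, C.cost (T (off L t) x) := by
  have h : ∀ s : (Fin d → Fin k) → C.S,
      (∏ t, C.W (T (off L t) x) (s t)) * Real.logb 2 ((∏ t, C.W (T (off L t) x) (s t)) /
        ∏ t, C.Q (s t)) = ∑ t, (∏ r, C.W (T (off L r) x) (s r)) *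
          Real.logb 2 (C.W (T (off L t) x) (s t) / C.Q (s t)) := by
    intro s
    rw [← Finset.mul_sum]
    by_cases h0 : ∏ t, C.W (T (off L t) x) (s t) = 0
    · rw [h0, zero_mul, zero_mul]
    · rw [← Finset.prod_div_distrib, Real.logb_prod]
      intro t ht
      have hw := Finset.prod_ne_zero_iff.1 h0 t ht
      exact div_ne_zero hw fun hq => hw (C.QW _ _ hq)
  change ∑ s : (Fin d → Fin k) → C.S, (∏ t, C.W (T (off L t) x) (s t)) *
    Real.logb 2 ((∏ t, C.W (T (off L t) x) (s t)) / ∏ t, C.Q (s t)) = _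
  simp only [h]
  rw [Finset.sum_comm]
  refine Finset.sum_congr rfl fun t _ => ?_
  exact sum_prod_marginal (fun r a => C.W (T (off L r) x) a) (fun r => C.W_sum _) t
    fun a => Real.logb 2 (C.W (T (off L t) x) a / C.Q a)

lemma Code.block_dst (C : Code X d L) (hT : IsContAction d T) {k : ℕ} (hk : 0 < k) (hL : 0 < L)
    {M : ℝ} (hM : k * L ≤ M) (x : X) :
    (C.block hT hk M).dst T x ≤ (M ^ d)⁻¹ * (∑ t : Fin d → Fin k, L ^ d * C.dst T (T (off L t) x) +
      dia X * (M ^ d - (k * L) ^ d)) := by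
  have hM0 : 0 ≤ M := le_trans (by positivity) hM
  refine mul_le_mul_of_nonneg_left ?_ (by positivity)
  change ∑ s : (Fin d → Fin k) → C.S, (∏ t, C.W (T (off L t) x) (s t)) *
    Dd d T M x (AEEqFun.mk (paste hk C.y s) (paste_measurable hk C.y s).aestronglyMeasurable) ≤ _
  calc _ ≤ ∑ s : (Fin d → Fin k) → C.S, (∏ t, C.W (T (off L t) x) (s t)) *
        (∑ t, Dd d T L (T (off L t) x) (C.y (s t)) + dia X * (M ^ d - (k * L) ^ d)) :=
        Finset.sum_le_sum fun s _ => mul_le_mul_of_nonneg_left (Dd_paste hT hk hL hM C.y s x)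
          (Finset.prod_nonneg fun t _ => C.W_nonneg _ _)
    _ = _ := by
        simp only [mul_add, Finset.sum_add_distrib, Finset.mul_sum]
        congr 1
        · rw [Finset.sum_comm]
          refine Finset.sum_congr rfl fun t _ => ?_
          rw [sum_prod_marginal (fun r a => C.W (T (off L r) x) a) (fun r => C.W_sum _) t
            fun a => Dd d T L (T (off L t) x) (C.y a)]
          rw [Code.dst, mul_inv_cancel_left₀ (pow_pos hL d).ne']
        · rw [← Finset.sum_mul, sum_prod_eq_one (fun t a => C.W (T (off L t) x) a)
            fun t => C.W_sum _, one_mul]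

lemma lintegral_action (hT : IsContAction d T) {ν : Measure X} (hν : MeasInvariant d T ν)
    (u : Fin d → ℝ) {g : X → ℝ≥0∞} (hg : Measurable g) : ∫⁻ x, g (T u x) ∂ν = ∫⁻ x, g x ∂ν := by
  conv_rhs => rw [← hν u]
  rw [lintegral_map hg (hT.cont_right u).measurable]

lemma exists_block (C : Code X d L) (hT : IsContAction d T) (hL : 0 < L) {η : ℝ} (hη : 0 < η) :
    ∃ M0 : ℝ, 0 < M0 ∧ ∀ M ≥ M0, ∃ C' : Code X d M, ∀ ν : Measure X, IsProbabilityMeasure ν →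
      MeasInvariant d T ν →
      (∫⁻ x, ENNReal.ofReal (C'.cost x) ∂ν) / ENNReal.ofReal (M ^ d) ≤
        (∫⁻ x, ENNReal.ofReal (C.cost x) ∂ν) / ENNReal.ofReal (L ^ d) ∧
      ∫⁻ x, ENNReal.ofReal (C'.dst T x) ∂ν ≤
        ∫⁻ x, ENNReal.ofReal (C.dst T x) ∂ν + ENNReal.ofReal η := by
  have hD : 0 ≤ dia X := dia_nonneg
  have hq : 0 ≤ dia X * d * L / η := by positivity
  refine ⟨L + dia X * d * L / η, by linarith, fun M hM => ?_⟩
  have hML : L ≤ M := by linarith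
  have hM0 : 0 < M := by linarith
  set k := ⌊M / L⌋₊ with hkdef
  have hk : 0 < k := Nat.floor_pos.2 ((one_le_div hL).2 hML)
  have hkM : k * L ≤ M := (le_div_iff₀ hL).1 (Nat.floor_le (by positivity))
  have hkM' : M < (k + 1) * L := (div_lt_iff₀ hL).1 (Nat.lt_floor_add_one _)
  have hMd := pow_pos hM0 d
  have hLd := pow_pos hL d
  have hkd : (k : ℝ) ^ d * L ^ d ≤ M ^ d := by
    rw [← mul_pow]; gcongr
  have hcard : (Fintype.card (Fin d → Fin k) : ℝ≥0∞) = ENNReal.ofReal ((k : ℝ) ^ d) := by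
    rw [ENNReal.ofReal_pow (by positivity)]; simp
  have herr : (M ^ d)⁻¹ * (dia X * (M ^ d - (k * L) ^ d)) ≤ η := by
    have h1 : 1 - d * (L / M) ≤ (k * L / M) ^ d := by
      have hb := one_add_mul_le_pow (a := -(L / M)) (by
        have : L / M ≤ 1 := (div_le_one hM0).2 hML
        linarith) d
      have h2 : (1 + -(L / M)) ^ d ≤ (k * L / M) ^ d := by
        have h3 : 0 ≤ 1 + -(L / M) := by
          have : L / M ≤ 1 := (div_le_one hM0).2 hML
          linarith
        refine pow_le_pow_left₀ h3 ?_ d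
        have : 1 + -(L / M) = (M - L) / M := by field_simp; ring
        rw [this]
        gcongr
        linarith
      linarith
    have h4 : (M ^ d)⁻¹ * (dia X * (M ^ d - (k * L) ^ d)) = dia X * (1 - (k * L / M) ^ d) := by
      rw [div_pow]; field_simp
    rw [h4]
    have h5 : dia X * (1 - (k * L / M) ^ d) ≤ dia X * (d * (L / M)) :=
      mul_le_mul_of_nonneg_left (by linarith) hD
    refine h5.trans ?_
    have h6 : dia X * d * L / η ≤ M := by linarith
    rw [div_le_iff₀ hη] at h6
    have : dia X * (d * (L / M)) = dia X * d * L / M := by ring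
    rw [this, div_le_iff₀ hM0]
    linarith
  refine ⟨C.block hT hk M, fun ν hν hinv => ⟨?_, ?_⟩⟩
  · have h1 : ∫⁻ x, ENNReal.ofReal ((C.block hT hk M).cost x) ∂ν =
        ENNReal.ofReal ((k : ℝ) ^ d) * ∫⁻ x, ENNReal.ofReal (C.cost x) ∂ν := by
      simp only [C.block_cost]
      have : ∀ x, ENNReal.ofReal (∑ t : Fin d → Fin k, C.cost (T (off L t) x)) =
          ∑ t : Fin d → Fin k, ENNReal.ofReal (C.cost (T (off L t) x)) := fun x =>
        ENNReal.ofReal_sum_of_nonneg fun t _ => C.cost_nonneg _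
      simp only [this]
      have hm : ∀ t : Fin d → Fin k, Measurable fun x => ENNReal.ofReal (C.cost (T (off L t) x)) :=
        fun t => (C.cost_measurable.comp (hT.cont_right _).measurable).ennreal_ofReal
      rw [lintegral_finsetSum _ fun t _ => hm t]
      have h2 : ∀ t : Fin d → Fin k, ∫⁻ x, ENNReal.ofReal (C.cost (T (off L t) x)) ∂ν =
          ∫⁻ x, ENNReal.ofReal (C.cost x) ∂ν := fun t =>
        lintegral_action hT hinv (off L t) C.cost_measurable.ennreal_ofReal
      simp only [h2]
      rw [Finset.sum_const, Finset.card_univ, nsmul_eq_mul, hcard]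
    rw [h1, mul_comm, ENNReal.div_eq_inv_mul, ENNReal.div_eq_inv_mul, mul_comm, mul_assoc, mul_comm]
    gcongr
    rw [← ENNReal.div_eq_inv_mul.trans (mul_comm _ _), ← ENNReal.ofReal_div_of_pos hMd,
      ← ENNReal.ofReal_inv_of_pos hLd]
    refine ENNReal.ofReal_le_ofReal ?_
    rw [div_le_iff₀ hMd, inv_mul_eq_div, le_div_iff₀ hLd]
    exact hkd
  · have hp : ∀ x, ENNReal.ofReal ((C.block hT hk M).dst T x) ≤
        (∑ t : Fin d → Fin k, ENNReal.ofReal ((M ^ d)⁻¹ * L ^ d) *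
          ENNReal.ofReal (C.dst T (T (off L t) x))) + ENNReal.ofReal η := by
      intro x
      refine (ENNReal.ofReal_le_ofReal (C.block_dst hT hk hL hkM x)).trans ?_
      rw [mul_add]
      refine ENNReal.ofReal_add_le.trans (add_le_add ?_ (ENNReal.ofReal_le_ofReal herr))
      rw [Finset.mul_sum, ENNReal.ofReal_sum_of_nonneg fun t _ => by
        have := C.dst_nonneg (T := T) hL (T (off L t) x)
        positivity]
      refine Finset.sum_le_sum fun t _ => ?_
      rw [← mul_assoc, ENNReal.ofReal_mul (by positivity)]
    refine (lintegral_mono hp).trans ?_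
    rw [lintegral_add_right _ measurable_const, lintegral_const, measure_univ, mul_one]
    refine add_le_add ?_ le_rfl
    have hm : ∀ t : Fin d → Fin k, Measurable fun x => ENNReal.ofReal (C.dst T (T (off L t) x)) :=
      fun t => ((C.dst_measurable hT).comp (hT.cont_right _).measurable).ennreal_ofReal
    rw [lintegral_finsetSum _ fun t _ => (hm t).const_mul _]
    have h2 : ∀ t : Fin d → Fin k, ∫⁻ x, ENNReal.ofReal ((M ^ d)⁻¹ * L ^ d) *
        ENNReal.ofReal (C.dst T (T (off L t) x)) ∂ν =
          ENNReal.ofReal ((M ^ d)⁻¹ * L ^ d) * ∫⁻ x, ENNReal.ofReal (C.dst T x) ∂ν := fun t => by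
      rw [lintegral_const_mul _ (hm t),
        lintegral_action hT hinv (off L t) (C.dst_measurable hT).ennreal_ofReal]
    simp only [h2]
    rw [Finset.sum_const, Finset.card_univ, nsmul_eq_mul, hcard, ← mul_assoc,
      ← ENNReal.ofReal_mul (by positivity)]
    refine mul_le_of_le_one_left zero_le ?_
    rw [ENNReal.ofReal_le_one]
    have : (k : ℝ) ^ d * ((M ^ d)⁻¹ * L ^ d) = (k ^ d * L ^ d) / M ^ d := by
      rw [div_eq_mul_inv]; ring
    rw [this, div_le_one hMd]
    exact hkd

end block

section family

variable {X : Type*} [MetricSpace X] [CompactSpace X] [MeasurableSpace X] [BorelSpace X]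
variable {d : ℕ} {T : (Fin d → ℝ) → X → X} {L : ℝ}

lemma invM_measurable_coe : Measurable fun ν : InvM X d T => (ν.1 : Measure X) :=
  measurable_subtype_coe.comp measurable_subtype_coe

lemma exists_index [Nonempty X] (hT : IsContAction d T) :
    ∃ (Mn : ℕ → ℝ) (Cn : ∀ n, Code X d (Mn n)), (∀ n, 0 < Mn n) ∧
      ∀ ν : Measure X, IsProbabilityMeasure ν → MeasInvariant d T ν → ∀ (ε : ℝ) (c : ℝ≥0∞),
        RD d T ν ε < c → ∃ n,
          (∫⁻ x, ENNReal.ofReal ((Cn n).cost x) ∂ν) / ENNReal.ofReal (Mn n ^ d) < c ∧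
          ∫⁻ x, ENNReal.ofReal ((Cn n).dst T x) ∂ν < ENNReal.ofReal ε := by
  have hpos : ∀ n : ℕ, (0 : ℝ) < (n : ℝ) + 1 := fun n => by positivity
  choose K hK hK' using fun n : ℕ => exists_countable_codes (X := X) hT (hpos n)
  let x0 : X := Classical.arbitrary X
  let K1 : ∀ n : ℕ, Set (Code X d ((n : ℝ) + 1)) := fun n => insert (Code.triv x0 d _) (K n)
  have hK1 : ∀ n, Countable (K1 n) := fun n => ((hK n).insert _).to_subtype
  let ι := Σ n : ℕ, K1 n
  have : Nonempty ι := ⟨⟨0, ⟨_, mem_insert _ _⟩⟩⟩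
  obtain ⟨e, he⟩ := exists_surjective_nat ι
  refine ⟨fun n => ((e n).1 : ℝ) + 1, fun n => (e n).2.1, fun n => hpos _, ?_⟩
  intro ν hν hinv ε c h
  simp only [RD, iInf_lt_iff] at h
  obtain ⟨L, hL, h⟩ := h
  have hLd : 0 < L ^ d := pow_pos hL d
  have hne : ENNReal.ofReal (L ^ d) ≠ 0 := (ENNReal.ofReal_pos.2 hLd).ne'
  rw [ENNReal.div_lt_iff (Or.inl hne) (Or.inl ENNReal.ofReal_ne_top)] at h
  obtain ⟨K2, -, hK2⟩ := exists_countable_codes (X := X) hT hL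
  obtain ⟨C, -, h1, h2⟩ := hK2 ν ε _ h
  obtain ⟨r, hr1, hr2⟩ := ENNReal.lt_iff_exists_add_pos_lt.1 h2
  obtain ⟨M0, hM0, hblock⟩ := exists_block C hT hL (show (0 : ℝ) < r from hr1)
  obtain ⟨n, hn⟩ := exists_nat_ge M0
  obtain ⟨C', hC'⟩ := hblock ((n : ℝ) + 1) (by linarith)
  obtain ⟨h3, h4⟩ := hC' ν hν hinv
  have h5 : ∫⁻ x, ENNReal.ofReal (C'.dst T x) ∂ν < ENNReal.ofReal ε := by
    refine lt_of_le_of_lt h4 ?_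
    rwa [ENNReal.ofReal_coe_nnreal]
  have hnd : (0 : ℝ) < ((n : ℝ) + 1) ^ d := pow_pos (hpos n) d
  have hne' : ENNReal.ofReal (((n : ℝ) + 1) ^ d) ≠ 0 := (ENNReal.ofReal_pos.2 hnd).ne'
  have h6 : RL d T ν ((n : ℝ) + 1) ε < c * ENNReal.ofReal (((n : ℝ) + 1) ^ d) := by
    refine lt_of_le_of_lt (RL_le_code hT (hpos n) C' ν h5) ?_
    rw [← ENNReal.div_lt_iff (Or.inl hne') (Or.inl ENNReal.ofReal_ne_top)]
    refine lt_of_le_of_lt h3 ?_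
    rwa [ENNReal.div_lt_iff (Or.inl hne) (Or.inl ENNReal.ofReal_ne_top)]
  obtain ⟨C2, hC2, h7, h8⟩ := hK' n ν ε _ h6
  obtain ⟨m, hm⟩ := he ⟨n, ⟨C2, mem_insert_of_mem _ hC2⟩⟩
  refine ⟨m, ?_⟩
  beta_reduce
  rw [hm]
  refine ⟨?_, h8⟩
  rw [ENNReal.div_lt_iff (Or.inl hne') (Or.inl ENNReal.ofReal_ne_top)]
  exact h7

end family

/-- Lemma 3.8: upper bound of the rate distortion function of a barycenter, for arbitrary
measurable positive distortion profiles. -/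
theorem RD_barycenter_le
    {X : Type*} [MetricSpace X] [CompactSpace X] [MeasurableSpace X] [BorelSpace X]
    (d : ℕ) (hd : 0 < d) (T : (Fin d → ℝ) → X → X) (hT : IsContAction d T)
    (lam : Measure (InvM X d T)) [IsProbabilityMeasure lam]
    (μ : Measure X) [IsProbabilityMeasure μ] (hμinv : MeasInvariant d T μ)
    (hbar : ∀ A : Set X, MeasurableSet A → μ A = ∫⁻ ν, (ν.1 : Measure X) A ∂lam)
    (ε : ℝ) (hε : 0 < ε)
    (f : InvM X d T → ℝ) (hf : Measurable f) (hfpos : ∀ ν, 0 < f ν)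
    (hfint : (∫⁻ ν, ENNReal.ofReal (f ν) ∂lam) ≤ ENNReal.ofReal ε) :
    RD d T μ ε ≤ ∫⁻ ν, RD d T (ν.1 : Measure X) (f ν) ∂lam := by
  have hX : Nonempty X := nonempty_of_isProbabilityMeasure μ
  obtain ⟨Mn, Cn, hMn, hidx⟩ := exists_index (X := X) hT
  let cst : ℕ → InvM X d T → ℝ≥0∞ := fun n ν =>
    (∫⁻ x, ENNReal.ofReal ((Cn n).cost x) ∂(ν.1 : Measure X)) / ENNReal.ofReal (Mn n ^ d)
  let ds : ℕ → InvM X d T → ℝ≥0∞ := fun n ν =>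
    ∫⁻ x, ENNReal.ofReal ((Cn n).dst T x) ∂(ν.1 : Measure X)
  have hcoe : Measurable fun ν : InvM X d T => (ν.1 : Measure X) := invM_measurable_coe
  have hcst : ∀ n, Measurable (cst n) := fun n =>
    ((Measure.measurable_lintegral (Cn n).cost_measurable.ennreal_ofReal).comp hcoe).div_const _
  have hds : ∀ n, Measurable (ds n) := fun n =>
    (Measure.measurable_lintegral ((Cn n).dst_measurable hT).ennreal_ofReal).comp hcoe
  have hfm : Measurable fun ν => ENNReal.ofReal (f ν) := hf.ennreal_ofReal
  let h : InvM X d T → ℝ≥0∞ := fun ν => ⨅ n, if ds n ν < ENNReal.ofReal (f ν) then cst n ν else ⊤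
  have hhm : Measurable h := by
    refine Measurable.iInf fun n => ?_
    exact Measurable.ite (measurableSet_lt (hds n) hfm) (hcst n) measurable_const
  have hhle : ∀ ν, h ν ≤ RD d T (ν.1 : Measure X) (f ν) := by
    intro ν
    refine le_of_forall_gt fun c hc => ?_
    obtain ⟨n, h1, h2⟩ := hidx (ν.1 : Measure X) inferInstance ν.2 (f ν) c hc
    refine lt_of_le_of_lt (iInf_le _ n) ?_
    rw [if_pos (show ds n ν < ENNReal.ofReal (f ν) from h2)]
    exact h1
  refine le_trans ?_ (lintegral_mono hhle)
  refine ENNReal.le_of_forall_pos_le_add fun η hη hfin => ?_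
  have hη2 : (0 : ℝ) < (η : ℝ) / 2 := half_pos hη
  have hae : ∀ᵐ ν ∂lam, h ν < ⊤ := ae_lt_top hhm hfin.ne
  let η' : ℝ≥0∞ := ENNReal.ofReal ((η : ℝ) / 2)
  have hη'0 : η' ≠ 0 := (ENNReal.ofReal_pos.2 hη2).ne'
  let G : ℕ → Set (InvM X d T) := fun n =>
    {ν | ds n ν < ENNReal.ofReal (f ν)} ∩ {ν | cst n ν < h ν + η'}
  have hG : ∀ n, MeasurableSet (G n) := fun n =>
    (measurableSet_lt (hds n) hfm).inter (measurableSet_lt (hcst n) (hhm.add_const _))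
  have hGcov : ∀ᵐ ν ∂lam, ν ∈ ⋃ n, G n := by
    filter_upwards [hae] with ν hν
    have h1 : h ν < h ν + η' := ENNReal.lt_add_right hν.ne hη'0
    obtain ⟨n, hn⟩ := iInf_lt_iff.1 h1
    refine mem_iUnion.2 ⟨n, ?_⟩
    by_cases hc : ds n ν < ENNReal.ofReal (f ν)
    · rw [if_pos hc] at hn
      exact ⟨hc, hn⟩
    · rw [if_neg hc] at hn
      exact absurd hn (by simp)
  let A : ℕ → Set (InvM X d T) := disjointed G
  have hA : ∀ n, MeasurableSet (A n) := fun n => MeasurableSet.disjointed hG n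
  have hAd : Pairwise (Function.onFun Disjoint A) := disjoint_disjointed G
  have hAG : ∀ n, A n ⊆ G n := fun n => disjointed_subset G n
  have hAcov : ∀ᵐ ν ∂lam, ν ∈ ⋃ n, A n := by
    simp only [A, iUnion_disjointed]; exact hGcov
  let D0 : ℝ≥0∞ := ∑' n, ∫⁻ ν in A n, ds n ν ∂lam
  have hD0 : D0 < ENNReal.ofReal ε := by
    let F : InvM X d T → ℝ≥0∞ := fun ν => ∑' n, (A n).indicator (ds n) ν
    have hF : ∫⁻ ν, F ν ∂lam = D0 := by
      simp only [F, D0]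
      rw [lintegral_tsum fun n => ((hds n).indicator (hA n)).aemeasurable]
      simp only [lintegral_indicator (hA _)]
    have hFlt : ∀ᵐ ν ∂lam, F ν < ENNReal.ofReal (f ν) := by
      filter_upwards [hAcov] with ν hν
      obtain ⟨n, hn⟩ := mem_iUnion.1 hν
      have : F ν = ds n ν := by
        simp only [F]
        rw [tsum_eq_single n, indicator_of_mem hn]
        intro m hm
        refine indicator_of_notMem (fun hm' => ?_) _
        exact Set.disjoint_left.1 (hAd hm) hm' hn
      rw [this]
      exact (hAG n hn).1
    have hFle : ∫⁻ ν, F ν ∂lam ≤ ∫⁻ ν, ENNReal.ofReal (f ν) ∂lam :=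
      lintegral_mono_ae (hFlt.mono fun _ h => h.le)
    have hFfin : ∫⁻ ν, F ν ∂lam ≠ ⊤ :=
      ((hFle.trans hfint).trans_lt ENNReal.ofReal_lt_top).ne
    rw [← hF]
    exact (lintegral_strict_mono (IsProbabilityMeasure.ne_zero lam) hfm.aemeasurable hFfin
      hFlt).trans_le hfint
  obtain ⟨r, hr, hrlt⟩ := ENNReal.lt_iff_exists_add_pos_lt.1 hD0
  have hr2 : (0 : ℝ) < (r : ℝ) / 2 := half_pos hr
  let r' : ℝ≥0∞ := ENNReal.ofReal ((r : ℝ) / 2)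
  have hrr : r' + r' = r := by
    simp only [r']
    rw [← ENNReal.ofReal_add hr2.le hr2.le, add_halves, ENNReal.ofReal_coe_nnreal]
  have hηη : η' + η' = η := by
    simp only [η']
    rw [← ENNReal.ofReal_add hη2.le hη2.le, add_halves, ENNReal.ofReal_coe_nnreal]
  let U : ℕ → Set (InvM X d T) := fun N => ⋃ i ∈ Finset.range N, A i
  have hU : ∀ N, MeasurableSet (U N) := fun N =>
    Finset.measurableSet_biUnion _ fun i _ => hA i
  -- choice of the truncation
  obtain ⟨N, hN⟩ : ∃ N, ENNReal.ofReal (dia X) * lam (U N)ᶜ ≤ r' := by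
    have hanti : Antitone fun N => (U N)ᶜ := by
      intro a b hab
      refine compl_subset_compl.2 ?_
      exact biUnion_subset_biUnion_left fun i hi =>
        Finset.mem_range.2 ((Finset.mem_range.1 hi).trans_le hab)
    have ht := tendsto_measure_iInter_atTop (μ := lam) (s := fun N => (U N)ᶜ)
      (fun N => (hU N).compl.nullMeasurableSet) hanti ⟨0, measure_ne_top _ _⟩
    have h0 : lam (⋂ N, (U N)ᶜ) = 0 := by
      rw [← compl_iUnion]
      refine measure_mono_null (compl_subset_compl.2 ?_) (mem_ae_iff.1 hAcov)
      intro ν hν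
      obtain ⟨n, hn⟩ := mem_iUnion.1 hν
      exact mem_iUnion.2 ⟨n + 1, mem_biUnion (Finset.mem_range.2 n.lt_succ_self) hn⟩
    rw [h0] at ht
    have ht2 := ENNReal.Tendsto.const_mul (a := ENNReal.ofReal (dia X)) ht
      (Or.inr ENNReal.ofReal_ne_top)
    rw [mul_zero] at ht2
    have hr'0 : 0 < r' := ENNReal.ofReal_pos.2 hr2
    obtain ⟨N, hN⟩ := (ht2.eventually (eventually_lt_nhds hr'0)).exists
    exact ⟨N, hN.le⟩
  have hsplit : ∀ g : InvM X d T → ℝ≥0∞,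
      ∑ i : Fin N, ∫⁻ ν in A i, g ν ∂lam + ∫⁻ ν in (U N)ᶜ, g ν ∂lam = ∫⁻ ν, g ν ∂lam := by
    intro g
    refine Eq.trans ?_ (lintegral_add_compl g (hU N))
    congr 1
    simp only [U]
    rw [lintegral_biUnion_finset (fun i _ j _ hij => hAd hij) (fun i _ => hA i),
      Finset.sum_range]
  choose M0 hM0 hblock using fun i => exists_block (Cn i) hT (hMn i) hr2
  have hlog : 0 ≤ Real.logb 2 ((N + 1 : ℕ) : ℝ) :=
    Real.logb_nonneg one_lt_two (by push_cast; linarith [(Nat.cast_nonneg N : (0 : ℝ) ≤ N)])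
  have hlogη : 0 ≤ Real.logb 2 ((N + 1 : ℕ) : ℝ) / ((η : ℝ) / 2) := div_nonneg hlog hη2.le
  obtain ⟨M, hM1, hMi, hMlog⟩ : ∃ M : ℝ, 1 ≤ M ∧ (∀ i : Fin N, M0 i ≤ M) ∧
      Real.logb 2 ((N + 1 : ℕ) : ℝ) / ((η : ℝ) / 2) ≤ M := by
    have hs : 0 ≤ ∑ i : Fin N, M0 i := Finset.sum_nonneg fun i _ => (hM0 i).le
    refine ⟨1 + ∑ i : Fin N, M0 i + Real.logb 2 ((N + 1 : ℕ) : ℝ) / ((η : ℝ) / 2), by linarith,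
      fun i => ?_, by linarith⟩
    have := Finset.single_le_sum (f := fun i : Fin N => M0 i) (fun i _ => (hM0 i).le)
      (Finset.mem_univ i)
    linarith
  have hMpos : 0 < M := by linarith
  have hMd := pow_pos hMpos d
  have hMdne : ENNReal.ofReal (M ^ d) ≠ 0 := (ENNReal.ofReal_pos.2 hMd).ne'
  choose C' hC' using fun i : Fin N => hblock i M (hMi i)
  let CC : Fin (N + 1) → Code X d M :=
    Fin.snoc (α := fun _ => Code X d M) C' (Code.triv (Classical.arbitrary X) d M)
  let part : Set (InvM X d T) → Measure X := fun S =>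
    (lam.restrict S).bind fun ν => (ν.1 : Measure X)
  let μμ : Fin (N + 1) → Measure X :=
    Fin.snoc (α := fun _ => Measure X) (fun i : Fin N => part (A i)) (part (U N)ᶜ)
  have hpart : ∀ (S : Set (InvM X d T)) (g : X → ℝ≥0∞), Measurable g →
      ∫⁻ x, g x ∂(part S) = ∫⁻ ν in S, ∫⁻ x, g x ∂(ν.1 : Measure X) ∂lam := fun S g hg =>
    Measure.lintegral_bind hcoe.aemeasurable hg.aemeasurable
  have hsum : ∑ i, μμ i = μ := by
    ext B hB
    rw [Measure.finsetSum_apply, Fin.sum_univ_castSucc, hbar B hB,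
      ← hsplit fun ν => (ν.1 : Measure X) B]
    simp only [μμ, Fin.snoc_castSucc, Fin.snoc_last, part]
    rw [Measure.bind_apply hB hcoe.aemeasurable]
    congr 1
    refine Finset.sum_congr rfl fun i _ => ?_
    rw [Measure.bind_apply hB hcoe.aemeasurable]
  have hprob : IsProbabilityMeasure (∑ i, μμ i) := by rw [hsum]; infer_instance
  have hdist : ∑ i, ∫⁻ x, ENNReal.ofReal ((CC i).dst T x) ∂(μμ i) < ENNReal.ofReal ε := by
    rw [Fin.sum_univ_castSucc]
    simp only [μμ, CC, Fin.snoc_castSucc, Fin.snoc_last]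
    have h1 : ∀ i : Fin N, ∫⁻ x, ENNReal.ofReal ((C' i).dst T x) ∂(part (A i)) ≤
        ∫⁻ ν in A i, ds i ν ∂lam + ∫⁻ _ν in A i, r' ∂lam := by
      intro i
      rw [hpart _ _ ((C' i).dst_measurable hT).ennreal_ofReal, ← lintegral_add_right _ measurable_const]
      exact lintegral_mono fun ν => (hC' i (ν.1 : Measure X) inferInstance ν.2).2
    have h2 : ∫⁻ x, ENNReal.ofReal ((Code.triv (Classical.arbitrary X) d M).dst T x)
        ∂(part (U N)ᶜ) ≤ r' := by
      rw [hpart _ _ ((Code.triv _ d M).dst_measurable hT).ennreal_ofReal]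
      calc _ ≤ ∫⁻ _ν in (U N)ᶜ, ENNReal.ofReal (dia X) ∂lam := by
            refine lintegral_mono fun ν => ?_
            refine (lintegral_mono (g := fun _ => ENNReal.ofReal (dia X)) fun x =>
              ENNReal.ofReal_le_ofReal ((Code.triv _ d M).dst_le hT hMpos x)).trans ?_
            simp
        _ ≤ r' := by simpa using hN
    have h3 : ∑ i : Fin N, ∫⁻ _ν in A i, r' ∂lam ≤ r' := by
      have := hsplit fun _ => r'
      refine (le_self_add.trans this.le).trans ?_
      rw [lintegral_const, measure_univ, mul_one]
    have h4 : ∑ i : Fin N, ∫⁻ ν in A i, ds i ν ∂lam ≤ D0 := by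
      rw [← Finset.sum_range (fun i => ∫⁻ ν in A i, ds i ν ∂lam)]
      exact ENNReal.sum_le_tsum _
    calc _ ≤ ∑ i : Fin N, (∫⁻ ν in A i, ds i ν ∂lam + ∫⁻ _ν in A i, r' ∂lam) + r' :=
          add_le_add (Finset.sum_le_sum fun i _ => h1 i) h2
      _ ≤ D0 + r' + r' := by
          rw [Finset.sum_add_distrib]
          exact add_le_add (add_le_add h4 h3) le_rfl
      _ = D0 + r := by rw [add_assoc, hrr]
      _ < ENNReal.ofReal ε := hrlt
  have hRL := RL_mix hT hMpos CC μμ hdist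
  rw [hsum] at hRL
  let κ : ℝ≥0∞ := ENNReal.ofReal (Real.logb 2 ((N + 1 : ℕ) : ℝ))
  have hcost : ∑ i, ∫⁻ x, ENNReal.ofReal ((CC i).cost x + Real.logb 2 ((N + 1 : ℕ) : ℝ)) ∂(μμ i) ≤
      ENNReal.ofReal (M ^ d) * (∫⁻ ν, h ν ∂lam + η') + κ := by
    rw [Fin.sum_univ_castSucc]
    simp only [μμ, CC, Fin.snoc_castSucc, Fin.snoc_last]
    let gg : InvM X d T → ℝ≥0∞ := fun ν => ENNReal.ofReal (M ^ d) * (h ν + η') + κ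
    have h1 : ∀ i : Fin N, ∫⁻ x, ENNReal.ofReal ((C' i).cost x + Real.logb 2 ((N + 1 : ℕ) : ℝ))
        ∂(part (A i)) ≤ ∫⁻ ν in A i, gg ν ∂lam := by
      intro i
      rw [hpart _ _ ((C' i).cost_measurable.add_const _).ennreal_ofReal]
      refine setLIntegral_mono' (hA i) fun ν hν => ?_
      have e1 : ∫⁻ x, ENNReal.ofReal ((C' i).cost x + Real.logb 2 ((N + 1 : ℕ) : ℝ))
          ∂(ν.1 : Measure X) = ∫⁻ x, ENNReal.ofReal ((C' i).cost x) ∂(ν.1 : Measure X) + κ := by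
        have : ∀ x, ENNReal.ofReal ((C' i).cost x + Real.logb 2 ((N + 1 : ℕ) : ℝ)) =
            ENNReal.ofReal ((C' i).cost x) + κ := fun x =>
          ENNReal.ofReal_add ((C' i).cost_nonneg x) hlog
        simp only [this]
        rw [lintegral_add_right _ measurable_const, lintegral_const, measure_univ, mul_one]
      rw [e1]
      refine add_le_add ?_ le_rfl
      have e2 := (hC' i (ν.1 : Measure X) inferInstance ν.2).1.trans (hAG i hν).2.le
      rw [ENNReal.div_le_iff hMdne ENNReal.ofReal_ne_top] at e2
      rw [mul_comm]
      exact e2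
    have h2 : ∫⁻ x, ENNReal.ofReal ((Code.triv (Classical.arbitrary X) d M).cost x +
        Real.logb 2 ((N + 1 : ℕ) : ℝ)) ∂(part (U N)ᶜ) ≤ ∫⁻ ν in (U N)ᶜ, gg ν ∂lam := by
      rw [hpart _ _ ((Code.triv _ d M).cost_measurable.add_const _).ennreal_ofReal]
      refine lintegral_mono fun ν => ?_
      simp only [Code.triv_cost, zero_add]
      rw [lintegral_const, measure_univ, mul_one]
      exact le_add_self
    calc _ ≤ ∑ i : Fin N, ∫⁻ ν in A i, gg ν ∂lam + ∫⁻ ν in (U N)ᶜ, gg ν ∂lam :=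
          add_le_add (Finset.sum_le_sum fun i _ => h1 i) h2
      _ = ∫⁻ ν, gg ν ∂lam := hsplit gg
      _ = _ := by
          simp only [gg]
          rw [lintegral_add_right _ measurable_const, lintegral_const_mul _ (hhm.add_const _),
            lintegral_add_right _ measurable_const]
          simp
  have hκ : κ ≤ ENNReal.ofReal (M ^ d) * η' := by
    simp only [κ, η']
    rw [← ENNReal.ofReal_mul hMd.le]
    refine ENNReal.ofReal_le_ofReal ?_
    rw [div_le_iff₀ hη2] at hMlog
    refine hMlog.trans (mul_le_mul_of_nonneg_right ?_ hη2.le)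
    exact le_self_pow₀ hM1 hd.ne'
  calc RD d T μ ε ≤ RL d T μ M ε / ENNReal.ofReal (M ^ d) := iInf₂_le M hMpos
    _ ≤ ∫⁻ ν, h ν ∂lam + η := by
        rw [ENNReal.div_le_iff hMdne ENNReal.ofReal_ne_top]
        refine (hRL.trans hcost).trans ?_
        refine (add_le_add le_rfl hκ).trans ?_
        rw [← mul_add, add_assoc, hηη, mul_comm]
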